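/- arXiv:2110.08686 — 4 statements merged into one kernel-verified Lean document; each statement's English description precedes it below -/
import Mathlib

section
/- Let S : ℝ ⇒ ℝⁿ be a smooth sweeping process such that S(t) is bounded for all t ∈ ℝ, and let [a,b] ⊂ dom(S) be such that H_S is continuous for the Hausdorff–Pompeiu metric on [a,b]. Then the oriented talweg function φ↑(t) = sup_{x ∈ S(t)} ‖D*S(t,x)|⁺ and the talweg function φ(t) = sup_{x ∈ S(t)} ‖D*S(t,x)‖⁺ are continuous on [a,b], where the image space ℝ ∪ {+∞} carries its usual topology. -/
open Set Metric Filter MeasureTheory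
open scoped ENNReal RealInnerProductSpace Topology Pointwise

section Preliminaries

variable {E : Type*} [NormedAddCommGroup E] [InnerProductSpace ℝ E]

/-- The graph `𝒮 = {(t,x) : x ∈ S t}` of a multivalued map `S : ℝ ⇒ E`. -/
def sgraph (S : ℝ → Set E) : Set (ℝ × E) := {p | p.2 ∈ S p.1}

/-- The effective domain of a multivalued map. -/
def sdom (S : ℝ → Set E) : Set ℝ := {t | (S t).Nonempty}

/-- The euclidean pairing on `ℝ × E`. -/
def pinner (p q : ℝ × E) : ℝ := p.1 * q.1 + ⟪p.2, q.2⟫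

/-- Fréchet normal cone of a set `C ⊆ E` at `x`. -/
def frechetNC (C : Set E) (x : E) : Set E :=
  {v | ∀ ε : ℝ, 0 < ε → ∃ δ : ℝ, 0 < δ ∧
    ∀ y ∈ C, ‖y - x‖ < δ → ⟪v, y - x⟫ ≤ ε * ‖y - x‖}

/-- Limiting (Mordukhovich) normal cone of a set `C ⊆ E` at `x`. -/
def limitingNC (C : Set E) (x : E) : Set E :=
  {v | ∃ xs vs : ℕ → E, (∀ i, xs i ∈ C) ∧ (∀ i, vs i ∈ frechetNC C (xs i)) ∧
    Tendsto xs atTop (𝓝 x) ∧ Tendsto vs atTop (𝓝 v)}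

/-- Fréchet normal cone of a set `C ⊆ ℝ × E` at `z` (w.r.t. the euclidean pairing). -/
def frechetNCP (C : Set (ℝ × E)) (z : ℝ × E) : Set (ℝ × E) :=
  {v | ∀ ε : ℝ, 0 < ε → ∃ δ : ℝ, 0 < δ ∧
    ∀ y ∈ C, ‖y - z‖ < δ → pinner v (y - z) ≤ ε * ‖y - z‖}

/-- Limiting normal cone of a set `C ⊆ ℝ × E` at `z`. -/
def limitingNCP (C : Set (ℝ × E)) (z : ℝ × E) : Set (ℝ × E) :=
  {v | ∃ zs vs : ℕ → ℝ × E, (∀ i, zs i ∈ C) ∧ (∀ i, vs i ∈ frechetNCP C (zs i)) ∧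
    Tendsto zs atTop (𝓝 z) ∧ Tendsto vs atTop (𝓝 v)}

/-- The (limiting) coderivative `D*S(t,x)(u) = {a : (a,-u) ∈ N_𝒮(t,x)}`. -/
def coderiv (S : ℝ → Set E) (t : ℝ) (x : E) (u : E) : Set ℝ :=
  {a | (a, -u) ∈ limitingNCP (sgraph S) (t, x)}

/-- Asymmetric (oriented) modulus `‖D*S(t,x)|⁺ = sup {a⁺ : a ∈ D*S(t,x)(u), ‖u‖ ≤ 1}`
(with `sup ∅ = 0`). -/
noncomputable def asymMod (S : ℝ → Set E) (t : ℝ) (x : E) : ℝ≥0∞ :=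
  ⨆ (u : E) (_ : ‖u‖ ≤ 1) (a : ℝ) (_ : a ∈ coderiv S t x u), ENNReal.ofReal a

/-- Modulus `‖D*S(t,x)‖⁺ = sup {|a| : a ∈ D*S(t,x)(u), ‖u‖ ≤ 1}` (with `sup ∅ = 0`). -/
noncomputable def symMod (S : ℝ → Set E) (t : ℝ) (x : E) : ℝ≥0∞ :=
  ⨆ (u : E) (_ : ‖u‖ ≤ 1) (a : ℝ) (_ : a ∈ coderiv S t x u), ENNReal.ofReal |a|

/-- Oriented talweg function `φ↑(t) = sup_{x ∈ S(t)} ‖D*S(t,x)|⁺`. -/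
noncomputable def orientedTalweg (S : ℝ → Set E) (t : ℝ) : ℝ≥0∞ :=
  ⨆ x ∈ S t, asymMod S t x

/-- Talweg function `φ(t) = sup_{x ∈ S(t)} ‖D*S(t,x)‖⁺`. -/
noncomputable def talweg (S : ℝ → Set E) (t : ℝ) : ℝ≥0∞ :=
  ⨆ x ∈ S t, symMod S t x

/-- `M` is a `C¹`-submanifold of codimension `c` of `ℝ × E`: locally it is the zero set
of a `C¹` submersion into `ℝ^c`. -/
def IsC1SubmanifoldCodim (c : ℕ) (M : Set (ℝ × E)) : Prop :=
  ∀ z ∈ M, ∃ U : Set (ℝ × E), IsOpen U ∧ z ∈ U ∧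
    ∃ f : ℝ × E → EuclideanSpace ℝ (Fin c),
      ContDiffOn ℝ 1 f U ∧ (∀ y ∈ U, Function.Surjective ⇑(fderivWithin ℝ f U y)) ∧
      M ∩ U = {y ∈ U | f y = 0}

/-- Smooth sweeping process: the graph `𝒮` is closed, connected, and either a `C¹`
submanifold of dimension at most `dim E` (i.e. codimension at least one), or a
full-dimensional manifold with boundary whose boundary `∂𝒮` (the topological frontier)
is a `C¹` submanifold of codimension one. -/
def SmoothSweepingProcess (S : ℝ → Set E) : Prop :=
  IsClosed (sgraph S) ∧ IsConnected (sgraph S) ∧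
    ((∃ c : ℕ, 1 ≤ c ∧ IsC1SubmanifoldCodim c (sgraph S)) ∨
      (sgraph S = closure (interior (sgraph S)) ∧
        IsC1SubmanifoldCodim 1 (frontier (sgraph S))))

/-- The map `H_S(t) = ∂𝒮 ∩ ({t} × E)`. -/
def HSmap (S : ℝ → Set E) (t : ℝ) : Set (ℝ × E) :=
  frontier (sgraph S) ∩ {p : ℝ × E | p.1 = t}

/-- Continuity at `t₀` (relative to `I`) of a set-valued map for the Hausdorff–Pompeiu
metric. -/
def HPContinuousAt {X : Type*} [PseudoEMetricSpace X] (F : ℝ → Set X) (I : Set ℝ)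
    (t₀ : ℝ) : Prop :=
  ∀ ε : ℝ, 0 < ε → ∃ δ : ℝ, 0 < δ ∧ ∀ t ∈ I, |t - t₀| < δ →
    EMetric.hausdorffEdist (F t) (F t₀) < ENNReal.ofReal ε

/-- Continuity on `I` of a set-valued map for the Hausdorff–Pompeiu metric. -/
def HPContinuousOn {X : Type*} [PseudoEMetricSpace X] (F : ℝ → Set X) (I : Set ℝ) : Prop :=
  ∀ t₀ ∈ I, HPContinuousAt F I t₀

/-- `γ` is absolutely continuous on `J` (with some integrable a.e. derivative). -/
def AbsContOn (γ : ℝ → E) (J : Set ℝ) : Prop :=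
  ∃ g : ℝ → E, IntegrableOn g J ∧ ∀ s ∈ J, ∀ t ∈ J, γ t - γ s = ∫ u in s..t, g u

/-- `γ` is piecewise absolutely continuous on `I`: its discontinuities are contained in a
closed countable set `D`, and `γ` is absolutely continuous on each connected component of
`I \ D`. -/
def PiecewiseAC (γ : ℝ → E) (I : Set ℝ) : Prop :=
  ∃ D : Set ℝ, IsClosed D ∧ D.Countable ∧
    ∀ t ∈ I \ D, AbsContOn γ (connectedComponentIn (I \ D) t)

/-- `γ` (an absolutely continuous curve, with a.e. derivative `γ'`) is an orbit of the
sweeping process defined by `S` on the interval `I`:  `γ(t) ∈ S(t)` on `I` and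
`-γ̇(t) ∈ N_{S(t)}(γ(t))` for a.e. `t ∈ I`. -/
def ACOrbit (S : ℝ → Set E) (I : Set ℝ) (γ γ' : ℝ → E) : Prop :=
  (∀ t ∈ I, γ t ∈ S t) ∧ IntegrableOn γ' I ∧
    (∀ s ∈ I, ∀ t ∈ I, γ t - γ s = ∫ u in s..t, γ' u) ∧
    (∀ᵐ t ∂(volume.restrict I), -γ' t ∈ limitingNC (S t) (γ t))

/-- `γ` (with a.e. derivative `γ'`) is a piecewise absolutely continuous orbit of the
sweeping process defined by `S` on `I`. -/
def PACOrbit (S : ℝ → Set E) (I : Set ℝ) (γ γ' : ℝ → E) : Prop :=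
  ∃ D : Set ℝ, IsClosed D ∧ D.Countable ∧
    ∀ t ∈ I \ D, ACOrbit S (connectedComponentIn (I \ D) t) γ γ'

/-- Assumption (A1): from every point `(t,x) ∈ 𝒮` with `‖D*S(t,x)|⁺ < ∞` there issues an
orbit of the sweeping process. -/
def AssumptionA1 (S : ℝ → Set E) : Prop :=
  ∀ t : ℝ, ∀ x ∈ S t, asymMod S t x < ⊤ →
    ∃ δ : ℝ, 0 < δ ∧ ∃ γ γ' : ℝ → E, ACOrbit S (Ico t (t + δ)) γ γ' ∧ γ t = x

/-- Assumption (A2) at `tb`: the oriented talweg is finite just to the right of `tb`. -/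
def AssumptionA2At (S : ℝ → Set E) (tb : ℝ) : Prop :=
  ∃ δ : ℝ, 0 < δ ∧ ∀ t ∈ Ioo tb (tb + δ), orientedTalweg S t < ⊤

/-- Assumption (A3) at `tb`: `H_S` is Hausdorff–Pompeiu continuous just to the right
of `tb`. -/
def AssumptionA3At (S : ℝ → Set E) (tb : ℝ) : Prop :=
  ∃ δ : ℝ, 0 < δ ∧ HPContinuousOn (HSmap S) (Ioo tb (tb + δ))

/-- The set `𝒯` of points of the domain at which (A2) and (A3) hold. -/
def goodSet (S : ℝ → Set E) : Set ℝ :=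
  {t | t ∈ sdom S ∧ AssumptionA2At S t ∧ AssumptionA3At S t}

/-- `S` has bounded values. -/
def BoundedValues (S : ℝ → Set E) : Prop := ∀ t, Bornology.IsBounded (S t)

/-- A catching-up sequence `{(tᵢ,xᵢ)}_{i ≥ 0}` for `S`. -/
def CatchingUp (S : ℝ → Set E) (t : ℕ → ℝ) (x : ℕ → E) : Prop :=
  StrictMono t ∧ (∀ i, x i ∈ S (t i)) ∧
    ∀ i, dist (x i) (x (i + 1)) = infDist (x i) (S (t (i + 1)))

/-- A finite catching-up sequence `{(tᵢ,xᵢ)}_{i=0}^k` for `S`. -/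
def FiniteCatchingUp (S : ℝ → Set E) (k : ℕ) (t : ℕ → ℝ) (x : ℕ → E) : Prop :=
  (∀ i < k, t i < t (i + 1)) ∧ (∀ i ≤ k, x i ∈ S (t i)) ∧
    ∀ i < k, dist (x i) (x (i + 1)) = infDist (x i) (S (t (i + 1)))

/-- A piecewise catching-up sequence for `S`: blocks `{(tʲᵢ,Yʲᵢ)}_{i=0}^{k_j}`, each a
catching-up sequence, with `tʲ_{k_j} = tʲ⁺¹₀`. -/
def PiecewiseCatchingUp (S : ℝ → Set E) (k : ℕ → ℕ) (t : ℕ → ℕ → ℝ) (Y : ℕ → ℕ → E) : Prop :=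
  (∀ j, FiniteCatchingUp S (k j) (t j) (Y j)) ∧ ∀ j, t j (k j) = t (j + 1) 0

/-- Outer semicontinuity of `S` at `tb`. -/
def OuterSemicontinuousAt (S : ℝ → Set E) (tb : ℝ) : Prop :=
  ∀ (tk : ℕ → ℝ) (xk : ℕ → E) (x : E), (∀ k, xk k ∈ S (tk k)) →
    Tendsto tk atTop (𝓝 tb) → Tendsto xk atTop (𝓝 x) → x ∈ S tb

/-- Inner semicontinuity of `S` at `tb`. -/
def InnerSemicontinuousAt (S : ℝ → Set E) (tb : ℝ) : Prop :=
  ∀ x ∈ S tb, ∀ tk : ℕ → ℝ, (∀ k, tk k ∈ sdom S) → Tendsto tk atTop (𝓝 tb) →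
    Tendsto (fun k => infDist x (S (tk k))) atTop (𝓝 0)

/-- The oriented calm graphical modulus `calm↑S(t,x)`. -/
noncomputable def calmUp (S : ℝ → Set E) (t : ℝ) (x : E) : ℝ :=
  sInf {κ : ℝ | 0 < κ ∧ ∃ ε : ℝ, 0 < ε ∧ ∃ δ : ℝ, 0 < δ ∧
    ∀ t₁ ∈ Ioo t (t + ε), S t ∩ ball x δ ⊆ S t₁ + ball (0 : E) (κ * (t₁ - t))}

end Preliminaries

section Helpers

variable {E : Type*} [NormedAddCommGroup E] [InnerProductSpace ℝ E]

/-- The pairing with a fixed vector, as a continuous linear functional. -/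
noncomputable def pcl (v : ℝ × E) : ℝ × E →L[ℝ] ℝ :=
  v.1 • ContinuousLinearMap.fst ℝ ℝ E + (innerSL ℝ v.2).comp (ContinuousLinearMap.snd ℝ ℝ E)

theorem pcl_apply (v p : ℝ × E) : pcl v p = pinner v p := by
  simp [pcl, pinner]

theorem continuous_pcl : Continuous (pcl : ℝ × E → (ℝ × E →L[ℝ] ℝ)) := by
  unfold pcl
  apply Continuous.add
  · fun_prop
  · have : Continuous (fun v : ℝ × E => innerSL ℝ v.2) :=
      (innerSL ℝ).continuous.comp continuous_snd
    exact this.clm_comp continuous_const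

/-- The vector representing a continuous linear functional. -/
noncomputable def prep [CompleteSpace E] (L : ℝ × E →L[ℝ] ℝ) : ℝ × E :=
  (L (1, 0), (InnerProductSpace.toDual ℝ E).symm (L.comp (ContinuousLinearMap.inr ℝ ℝ E)))

theorem pinner_prep [CompleteSpace E] (L : ℝ × E →L[ℝ] ℝ) (p : ℝ × E) :
    pinner (prep L) p = L p := by
  have h : p = p.1 • ((1 : ℝ), (0 : E)) + (0, p.2) := by ext <;> simp
  conv_rhs => rw [h, map_add, map_smul]
  simp [pinner, prep, mul_comm]

theorem continuous_prep [CompleteSpace E] :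
    Continuous (prep : (ℝ × E →L[ℝ] ℝ) → ℝ × E) := by
  unfold prep
  apply Continuous.prodMk
  · fun_prop
  · apply (InnerProductSpace.toDual ℝ E).symm.continuous.comp
    exact continuous_id.clm_comp continuous_const

theorem pinner_self_le {v : ℝ × E} (h : pinner v v ≤ 0) : v = 0 := by
  unfold pinner at h
  rw [real_inner_self_eq_norm_sq] at h
  have h1 : v.1 = 0 := by nlinarith [sq_nonneg v.1, sq_nonneg ‖v.2‖]
  have h2 : ‖v.2‖ = 0 := by
    have : ‖v.2‖ ^ 2 ≤ 0 := by nlinarith [sq_nonneg v.1]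
    nlinarith [norm_nonneg v.2]
  exact Prod.ext h1 (norm_eq_zero.1 h2)

theorem pinner_ext [CompleteSpace E] {v w : ℝ × E} (h : ∀ p, pinner v p = pinner w p) :
    v = w := by
  have : v - w = 0 := by
    apply pinner_self_le
    have h0 := h (v - w)
    have : pinner (v - w) (v - w) = pinner v (v - w) - pinner w (v - w) := by
      simp only [pinner, Prod.fst_sub, Prod.snd_sub, inner_sub_left]; ring
    rw [this, h0]; simp
  exact sub_eq_zero.1 this

/-- Fréchet normals are nonpositive on tangent directions. -/
theorem pinner_tangent {C : Set (ℝ × E)} {y v h : ℝ × E} (hv : v ∈ frechetNCP C y)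
    (g : ℝ → ℝ × E) (hg0 : g 0 = y) (hg : HasDerivAt g h 0)
    (hC : ∀ᶠ s in 𝓝[>] (0 : ℝ), g s ∈ C) : pinner v h ≤ 0 := by
  have key : ∀ ε : ℝ, 0 < ε → pinner v h ≤ ε * ‖h‖ := by
    intro ε hε
    obtain ⟨δ, hδ, H⟩ := hv ε hε
    have hs : Tendsto (fun s : ℝ => s⁻¹ • (g s - y)) (𝓝[>] 0) (𝓝 h) := by
      have := hg.tendsto_slope_zero_right
      simpa [hg0] using this
    have hcont : ∀ᶠ s in 𝓝[>] (0 : ℝ), ‖g s - y‖ < δ := by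
      have : Tendsto (fun s => ‖g s - y‖) (𝓝 0) (𝓝 0) := by
        have h1 : Tendsto g (𝓝 0) (𝓝 y) := hg0 ▸ hg.continuousAt.tendsto
        simpa using (h1.sub_const y).norm
      exact (this.mono_left nhdsWithin_le_nhds).eventually (gt_mem_nhds hδ)
    have hl : Tendsto (fun s : ℝ => pcl v (s⁻¹ • (g s - y))) (𝓝[>] 0) (𝓝 (pcl v h)) :=
      ((pcl v).continuous.tendsto h).comp hs
    rw [pcl_apply] at hl
    refine le_of_tendsto_of_tendsto hl (hs.norm.const_mul ε) ?_
    filter_upwards [hC, hcont, self_mem_nhdsWithin] with s h1 h2 h3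
    have h3 : 0 < s := h3
    have := H _ h1 h2
    rw [map_smul, pcl_apply, norm_smul, Real.norm_of_nonneg (inv_nonneg.2 h3.le), smul_eq_mul]
    have h4 : 0 < s⁻¹ := inv_pos.2 h3
    nlinarith [mul_le_mul_of_nonneg_left this h4.le]
  by_contra hcon
  push Not at hcon
  have := key (pinner v h / (2 * (‖h‖ + 1))) (by positivity)
  have hn : 0 ≤ ‖h‖ := norm_nonneg h
  rw [div_mul_eq_mul_div, le_div_iff₀ (by positivity)] at this
  nlinarith

theorem zero_mem_frechetNCP (C : Set (ℝ × E)) (y : ℝ × E) : (0 : ℝ × E) ∈ frechetNCP C y := by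
  intro ε hε
  refine ⟨1, one_pos, fun y' _ _ => ?_⟩
  simp only [pinner, Prod.fst_zero, Prod.snd_zero, inner_zero_left, zero_mul, add_zero]
  positivity

theorem frechet_interior {C : Set (ℝ × E)} {y v : ℝ × E} (hy : y ∈ interior C)
    (hv : v ∈ frechetNCP C y) : v = 0 := by
  apply pinner_self_le
  have hd : HasDerivAt (fun s : ℝ => y + s • v) v 0 := by
    simpa using ((hasDerivAt_id (0 : ℝ)).smul_const v).const_add y
  refine pinner_tangent hv (fun s : ℝ => y + s • v) (by simp) hd ?_
  apply nhdsWithin_le_nhds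
  have h1 : Tendsto (fun s : ℝ => y + s • v) (𝓝 0) (𝓝 y) := by
    have := hd.continuousAt.tendsto
    simpa using this
  exact h1.eventually (mem_interior_iff_mem_nhds.1 hy)

theorem limiting_interior {C : Set (ℝ × E)} {y v : ℝ × E} (hy : y ∈ interior C)
    (hv : v ∈ limitingNCP C y) : v = 0 := by
  obtain ⟨zs, vs, -, h2, h3, h4⟩ := hv
  have : ∀ᶠ i in atTop, vs i = 0 := by
    filter_upwards [h3.eventually (isOpen_interior.mem_nhds hy)] with i hi
    exact frechet_interior hi (h2 i)
  exact tendsto_nhds_unique h4 (tendsto_const_nhds.congr' (this.mono fun _ h => h.symm))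

theorem limiting_mem {C : Set (ℝ × E)} (hC : IsClosed C) {y v : ℝ × E}
    (hv : v ∈ limitingNCP C y) : y ∈ C := by
  obtain ⟨zs, vs, h1, -, h3, -⟩ := hv
  exact hC.mem_of_tendsto h3 (Eventually.of_forall h1)

theorem frechet_smul {C : Set (ℝ × E)} {y v : ℝ × E} (hv : v ∈ frechetNCP C y) {r : ℝ}
    (hr : 0 ≤ r) : r • v ∈ frechetNCP C y := by
  intro ε hε
  obtain ⟨δ, hδ, H⟩ := hv (ε / (r + 1)) (by positivity)
  refine ⟨δ, hδ, fun y' h1 h2 => ?_⟩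
  have h3 := H y' h1 h2
  have : pinner (r • v) (y' - y) = r * pinner v (y' - y) := by
    simp [pinner, real_inner_smul_left]; ring
  rw [this]
  have h4 : r * (ε / (r + 1)) ≤ ε := by
    rw [mul_div_assoc', div_le_iff₀ (by positivity)]; nlinarith
  calc r * pinner v (y' - y) ≤ r * (ε / (r + 1) * ‖y' - y‖) := by gcongr
    _ = r * (ε / (r + 1)) * ‖y' - y‖ := by ring
    _ ≤ _ := by gcongr

theorem limiting_smul {C : Set (ℝ × E)} {y v : ℝ × E} (hv : v ∈ limitingNCP C y) {r : ℝ}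
    (hr : 0 ≤ r) : r • v ∈ limitingNCP C y := by
  obtain ⟨zs, vs, h1, h2, h3, h4⟩ := hv
  exact ⟨zs, fun i => r • vs i, h1, fun i => frechet_smul (h2 i) hr, h3, h4.const_smul r⟩

theorem frechet_sub_limiting {C : Set (ℝ × E)} {y v : ℝ × E} (hy : y ∈ C)
    (hv : v ∈ frechetNCP C y) : v ∈ limitingNCP C y :=
  ⟨fun _ => y, fun _ => v, fun _ => hy, fun _ => hv, tendsto_const_nhds, tendsto_const_nhds⟩

/-- The graph of the limiting normal cone is closed. -/
theorem limiting_closed {C : Set (ℝ × E)} {y v : ℝ × E} {zs vs : ℕ → ℝ × E}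
    (h : ∀ i, vs i ∈ limitingNCP C (zs i)) (hz : Tendsto zs atTop (𝓝 y))
    (hv : Tendsto vs atTop (𝓝 v)) : v ∈ limitingNCP C y := by
  have hpos : ∀ i : ℕ, (0 : ℝ) < 1 / ((i : ℝ) + 1) := fun i => Nat.one_div_pos_of_nat
  have : ∀ i : ℕ, ∃ z' v', z' ∈ C ∧ v' ∈ frechetNCP C z' ∧ dist z' (zs i) < 1 / ((i : ℝ) + 1) ∧
      dist v' (vs i) < 1 / ((i : ℝ) + 1) := by
    intro i
    obtain ⟨z, w, h1, h2, h3, h4⟩ := h i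
    obtain ⟨j, hj1, hj2⟩ := ((h3.eventually (Metric.ball_mem_nhds _ (hpos i))).and
      (h4.eventually (Metric.ball_mem_nhds _ (hpos i)))).exists
    exact ⟨z j, w j, h1 j, h2 j, hj1, hj2⟩
  choose z' v' h1 h2 h3 h4 using this
  have ht := tendsto_one_div_add_atTop_nhds_zero_nat (𝕜 := ℝ)
  refine ⟨z', v', h1, h2, ?_, ?_⟩
  · refine (tendsto_iff_of_dist ?_).2 hz
    exact squeeze_zero (fun _ => dist_nonneg) (fun i => (h3 i).le) ht
  · refine (tendsto_iff_of_dist ?_).2 hv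
    exact squeeze_zero (fun _ => dist_nonneg) (fun i => (h4 i).le) ht

/-- Inner semicontinuity of the normal cone along the frontier, at `z`. -/
def InnerNC (C : Set (ℝ × E)) (z : ℝ × E) : Prop :=
  ∀ v ∈ limitingNCP C z, ∀ ε : ℝ, 0 < ε → ∃ δ : ℝ, 0 < δ ∧ ∀ z' ∈ frontier C, dist z' z < δ →
    ∃ v' ∈ frechetNCP C z', dist v' v < ε

/-- Generic talweg. -/
noncomputable def gTal (g : ℝ → ℝ) (S : ℝ → Set E) (t : ℝ) : ℝ≥0∞ :=
  ⨆ x ∈ S t, ⨆ (u : E) (_ : ‖u‖ ≤ 1) (a : ℝ) (_ : a ∈ coderiv S t x u), ENNReal.ofReal (g a)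

theorem lt_gTal {g : ℝ → ℝ} {S : ℝ → Set E} {t : ℝ} {c : ℝ≥0∞} :
    c < gTal g S t ↔ ∃ x ∈ S t, ∃ u : E, ‖u‖ ≤ 1 ∧ ∃ a ∈ coderiv S t x u,
      c < ENNReal.ofReal (g a) := by
  simp only [gTal, lt_iSup_iff, exists_prop]

theorem le_gTal {g : ℝ → ℝ} {S : ℝ → Set E} {t : ℝ} {x u : E} {a : ℝ} (hx : x ∈ S t)
    (hu : ‖u‖ ≤ 1) (ha : a ∈ coderiv S t x u) : ENNReal.ofReal (g a) ≤ gTal g S t := by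
  unfold gTal
  exact le_iSup₂_of_le x hx (le_iSup₂_of_le u hu (le_iSup₂_of_le a ha le_rfl))

theorem gTal_continuousOn [FiniteDimensional ℝ E] {g : ℝ → ℝ} (hg : Continuous g)
    (hg0 : g 0 = 0) (hgh : ∀ r a, 0 ≤ r → g (r * a) = r * g a)
    (hga : ∀ a, 0 < g a → |a| ≤ g a)
    {S : ℝ → Set E} (hcl : IsClosed (sgraph S))
    (hin : ∀ z ∈ frontier (sgraph S), InnerNC (sgraph S) z)
    (hbv : BoundedValues S) {a b : ℝ} (hHS : HPContinuousOn (HSmap S) (Icc a b)) :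
    ContinuousOn (gTal g S) (Icc a b) := by
  -- nonzero normals live on the frontier
  have hfr : ∀ t x u α, 0 < g α → α ∈ coderiv S t x u → (t, x) ∈ frontier (sgraph S) := by
    intro t x u α h1 h2
    have h2 : (α, -u) ∈ limitingNCP (sgraph S) (t, x) := h2
    rw [frontier, hcl.closure_eq]
    refine ⟨limiting_mem hcl h2, fun h3 => ?_⟩
    have := congrArg Prod.fst (limiting_interior h3 h2)
    simp only [Prod.fst_zero] at this
    rw [this, hg0] at h1
    exact lt_irrefl _ h1
  intro t₀ ht₀
  refine tendsto_order.2 ⟨fun c hc => ?_, fun c hc => ?_⟩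
  · obtain ⟨x, hx, u, hu, α, hα, hcα⟩ := lt_gTal.1 hc
    have hgα : 0 < g α := ENNReal.ofReal_pos.1 (lt_of_le_of_lt zero_le hcα)
    have hz := hfr _ _ _ _ hgα hα
    -- shrink
    obtain ⟨θ, hθ0, hθ1, hθc⟩ : ∃ θ : ℝ, 0 < θ ∧ θ < 1 ∧ c < ENNReal.ofReal (g (θ * α)) := by
      have hct : Tendsto (fun θ : ℝ => ENNReal.ofReal (g (θ * α))) (𝓝[<] 1)
          (𝓝 (ENNReal.ofReal (g (1 * α)))) := by
        have : Continuous (fun θ : ℝ => ENNReal.ofReal (g (θ * α))) :=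
          ENNReal.continuous_ofReal.comp (by fun_prop)
        exact (this.tendsto 1).mono_left nhdsWithin_le_nhds
      rw [one_mul] at hct
      obtain ⟨θ, h1, h2⟩ := ((hct.eventually (lt_mem_nhds hcα)).and
        (Ioo_mem_nhdsLT (zero_lt_one' ℝ))).exists
      exact ⟨θ, h2.1, h2.2, h1⟩
    have hv : θ • (α, -u) ∈ limitingNCP (sgraph S) (t₀, x) := limiting_smul hα hθ0.le
    have hop : ∀ᶠ v : ℝ × E in 𝓝 (θ • (α, -u)), ‖v.2‖ < 1 ∧ c < ENNReal.ofReal (g v.1) := by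
      apply Filter.Eventually.and
      · have : Tendsto (fun v : ℝ × E => ‖v.2‖) (𝓝 (θ • (α, -u)))
            (𝓝 (‖(θ • (α, -u)).2‖)) :=
          (continuous_snd.norm).tendsto _
        refine this.eventually (gt_mem_nhds ?_)
        simp only [Prod.smul_snd, norm_smul, norm_neg, Real.norm_of_nonneg hθ0.le]
        nlinarith [norm_nonneg u]
      · have hc2 : Continuous (fun v : ℝ × E => ENNReal.ofReal (g v.1)) :=
          ENNReal.continuous_ofReal.comp (by fun_prop)
        refine (hc2.tendsto _).eventually (lt_mem_nhds ?_)
        simpa using hθc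
    obtain ⟨ε, hε, hεv⟩ := Metric.eventually_nhds_iff.1 hop
    obtain ⟨δ, hδ, hK⟩ := hin _ hz _ hv ε hε
    obtain ⟨η, hη, hH⟩ := hHS t₀ ht₀ δ hδ
    have hnear : ∀ᶠ t in 𝓝[Icc a b] t₀, |t - t₀| < η :=
      nhdsWithin_le_nhds (Metric.ball_mem_nhds t₀ hη)
    filter_upwards [hnear, self_mem_nhdsWithin] with t h1 h2
    have hd := hH t h2 h1
    have hmem : ((t₀, x) : ℝ × E) ∈ HSmap S t₀ := ⟨hz, rfl⟩
    obtain ⟨z', hz', hdz⟩ := Metric.exists_edist_lt_of_hausdorffEDist_lt hmem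
      (by rw [Metric.hausdorffEDist_comm]; exact hd)
    rw [edist_comm, edist_lt_ofReal] at hdz
    obtain ⟨v', hv', hvd⟩ := hK z' hz'.1 hdz
    obtain ⟨h5, h6⟩ := hεv hvd
    have hzC : z' ∈ sgraph S := hcl.frontier_subset hz'.1
    obtain ⟨t', x'⟩ := z'
    have htt : t' = t := hz'.2
    subst htt
    refine lt_gTal.2 ⟨x', hzC, -v'.2, by simpa using h5.le, v'.1, ?_, h6⟩
    change (v'.1, - -v'.2) ∈ limitingNCP (sgraph S) (t', x')
    rw [neg_neg]
    exact frechet_sub_limiting hzC hv'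
  · by_contra hcon
    have hcon : ∃ᶠ t in 𝓝[Icc a b] t₀, ¬ gTal g S t < c :=
      not_eventually.1 hcon
    obtain ⟨c', hc1, hc2⟩ := exists_between hc
    have hc'top : c' ≠ ⊤ := (lt_of_lt_of_le hc2 le_top).ne
    have hc'0 : c' ≠ 0 := (lt_of_le_of_lt zero_le hc1).ne'
    set r := c'.toReal with hr
    have hr0 : 0 < r := ENNReal.toReal_pos hc'0 hc'top
    have hcr : c' = ENNReal.ofReal r := (ENNReal.ofReal_toReal hc'top).symm
    obtain ⟨η, hη, hH⟩ := hHS t₀ ht₀ 1 one_pos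
    have hnear : ∀ᶠ t in 𝓝[Icc a b] t₀, |t - t₀| < η :=
      nhdsWithin_le_nhds (Metric.ball_mem_nhds t₀ hη)
    have hcon2 := hcon.and_eventually (hnear.and self_mem_nhdsWithin)
    obtain ⟨ts, hts, hP⟩ := exists_seq_forall_of_frequently hcon2
    have hts : Tendsto ts atTop (𝓝 t₀) := hts.mono_right nhdsWithin_le_nhds
    -- normalised data
    have hex : ∀ k, ∃ z v : ℝ × E, z ∈ HSmap S (ts k) ∧ v ∈ limitingNCP (sgraph S) z ∧
        ‖v.2‖ ≤ 1 ∧ g v.1 = r ∧ |v.1| ≤ r := by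
      intro k
      have h1 : c' < gTal g S (ts k) := lt_of_lt_of_le hc2 (not_lt.1 (hP k).1)
      obtain ⟨x, hx, u, hu, α, hα, hcα⟩ := lt_gTal.1 h1
      rw [hcr, ENNReal.ofReal_lt_ofReal_iff_of_nonneg hr0.le] at hcα
      have hgα : 0 < g α := hr0.trans hcα
      have hq : 0 ≤ r / g α := by positivity
      have hq1 : r / g α ≤ 1 := (div_le_one hgα).2 hcα.le
      have hgr : g (r / g α * α) = r := by rw [hgh _ _ hq]; field_simp
      refine ⟨(ts k, x), (r / g α) • (α, -u), ⟨hfr _ _ _ _ hgα hα, rfl⟩, limiting_smul hα hq,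
        ?_, ?_, ?_⟩
      · simp only [Prod.smul_snd, norm_smul, norm_neg, Real.norm_of_nonneg hq]
        nlinarith [norm_nonneg u]
      · simpa using hgr
      · have := hga (r / g α * α) (by rw [hgr]; exact hr0)
        rw [hgr] at this
        simpa using this
    choose z v hz hv hv2 hgv hv1 using hex
    have hbd : Bornology.IsBounded (HSmap S t₀) := by
      have : HSmap S t₀ ⊆ {t₀} ×ˢ S t₀ := by
        rintro ⟨t, x⟩ ⟨h1, h2⟩
        have h2 : t = t₀ := h2
        subst h2
        exact ⟨rfl, hcl.frontier_subset h1⟩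
      exact (Bornology.isBounded_singleton.prod (hbv t₀)).subset this
    have hzb : ∀ k, z k ∈ Metric.thickening 1 (HSmap S t₀) := by
      intro k
      obtain ⟨y, hy, hd⟩ := Metric.exists_edist_lt_of_hausdorffEDist_lt (hz k)
        (hH (ts k) (hP k).2.2 (hP k).2.1)
      rw [edist_lt_ofReal] at hd
      exact Metric.mem_thickening_iff.2 ⟨y, hy, hd⟩
    have hvb : ∀ k, v k ∈ Metric.closedBall (0 : ℝ × E) (max r 1) := by
      intro k
      rw [mem_closedBall_zero_iff, Prod.norm_def]
      exact max_le_max (hv1 k) (hv2 k)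
    obtain ⟨⟨z₀, v₀⟩, -, ψ, hψ, hlim⟩ := tendsto_subseq_of_bounded
      (hbd.thickening.prod Metric.isBounded_closedBall)
      (x := fun k => (z k, v k)) (fun k => Set.mk_mem_prod (hzb k) (hvb k))
    have hzl : Tendsto (z ∘ ψ) atTop (𝓝 z₀) := (continuous_fst.tendsto _).comp hlim
    have hvl : Tendsto (v ∘ ψ) atTop (𝓝 v₀) := (continuous_snd.tendsto _).comp hlim
    have hN : v₀ ∈ limitingNCP (sgraph S) z₀ := limiting_closed (fun i => hv (ψ i)) hzl hvl
    have hz1 : z₀.1 = t₀ := by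
      have h1 : Tendsto (fun i => (z (ψ i)).1) atTop (𝓝 z₀.1) :=
        (continuous_fst.tendsto _).comp hzl
      have h2 : (fun i => (z (ψ i)).1) = ts ∘ ψ := funext fun i => (hz (ψ i)).2
      rw [h2] at h1
      exact tendsto_nhds_unique h1 (hts.comp hψ.tendsto_atTop)
    have hg1 : g v₀.1 = r := by
      have h1 : Tendsto (fun i => g (v (ψ i)).1) atTop (𝓝 (g v₀.1)) :=
        ((hg.comp continuous_fst).tendsto _).comp hvl
      simp only [hgv] at h1
      exact tendsto_nhds_unique tendsto_const_nhds h1 |>.symm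
    have hn1 : ‖v₀.2‖ ≤ 1 := by
      have h1 : Tendsto (fun i => ‖(v (ψ i)).2‖) atTop (𝓝 ‖v₀.2‖) :=
        ((continuous_snd.norm).tendsto _).comp hvl
      exact le_of_tendsto h1 (Eventually.of_forall fun i => hv2 _)
    obtain ⟨t', x'⟩ := z₀
    have hz1 : t' = t₀ := hz1
    subst hz1
    have hmem : x' ∈ S t' := limiting_mem hcl hN
    have : ENNReal.ofReal (g v₀.1) ≤ gTal g S t' := by
      refine le_gTal hmem (u := -v₀.2) (by simpa using hn1) ?_
      change (v₀.1, - -v₀.2) ∈ limitingNCP (sgraph S) (t', x')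
      rw [neg_neg]
      exact hN
    rw [hg1, ← hcr] at this
    exact absurd hc1 (not_lt.2 this)

theorem tendsto_clm_comp {ι X Y Z : Type*} [NormedAddCommGroup X] [NormedSpace ℝ X]
    [NormedAddCommGroup Y] [NormedSpace ℝ Y] [NormedAddCommGroup Z] [NormedSpace ℝ Z]
    {l : Filter ι} {f : ι → Y →L[ℝ] Z} {g : ι → X →L[ℝ] Y} {f₀ : Y →L[ℝ] Z} {g₀ : X →L[ℝ] Y}
    (hf : Tendsto f l (𝓝 f₀)) (hg : Tendsto g l (𝓝 g₀)) :
    Tendsto (fun i => (f i).comp (g i)) l (𝓝 (f₀.comp g₀)) := by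
  have h : Continuous (fun p : (Y →L[ℝ] Z) × (X →L[ℝ] Y) => p.1.comp p.2) :=
    continuous_fst.clm_comp continuous_snd
  exact (h.tendsto (f₀, g₀)).comp (hf.prodMk_nhds hg)

/-- From a local description of the Fréchet normals to inner semicontinuity. -/
theorem innerNC_of_local [FiniteDimensional ℝ E] {F : Type*} [NormedAddCommGroup F]
    [NormedSpace ℝ F] [FiniteDimensional ℝ F] {C U : Set (ℝ × E)} {z : ℝ × E}
    (hU : IsOpen U) (hz : z ∈ U)
    (A : ℝ × E → (ℝ × E →L[ℝ] F)) (hA : ContinuousAt A z) (hs : Function.Surjective (A z))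
    (W : Set (F →L[ℝ] ℝ)) (hW : IsClosed W)
    (h1 : ∀ y ∈ U, y ∈ C → ∀ v ∈ frechetNCP C y, ∃ w ∈ W, ∀ p, pinner v p = w (A y p))
    (h2 : ∀ y ∈ U, y ∈ frontier C → ∀ w ∈ W, ∀ v, (∀ p, pinner v p = w (A y p)) →
      v ∈ frechetNCP C y) : InnerNC C z := by
  have : CompleteSpace F := FiniteDimensional.complete ℝ F
  have : CompleteSpace E := FiniteDimensional.complete ℝ E
  intro v hv ε hε
  obtain ⟨R, hR⟩ := (A z).exists_rightInverse_of_surjective (LinearMap.range_eq_top.2 hs)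
  obtain ⟨zs, vs, hzs, hvs, hlz, hlv⟩ := hv
  have hex : ∀ i, ∃ w : F →L[ℝ] ℝ, zs i ∈ U → w ∈ W ∧ pcl (vs i) = w.comp (A (zs i)) := by
    intro i
    by_cases hi : zs i ∈ U
    · obtain ⟨w, hw, hp⟩ := h1 _ hi (hzs i) _ (hvs i)
      exact ⟨w, fun _ => ⟨hw, ContinuousLinearMap.ext fun p => by rw [pcl_apply, hp]; rfl⟩⟩
    · exact ⟨0, fun h => absurd h hi⟩
  choose w hw using hex
  have hlA : Tendsto (fun i => A (zs i)) atTop (𝓝 (A z)) := hA.tendsto.comp hlz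
  have hlB : Tendsto (fun i => (A (zs i)).comp R) atTop (𝓝 (1 : F →L[ℝ] F)) := by
    have h := tendsto_clm_comp hlA (tendsto_const_nhds (x := R))
    rwa [hR] at h
  have hlp : Tendsto (fun i => pcl (vs i)) atTop (𝓝 (pcl v)) :=
    (continuous_pcl.tendsto v).comp hlv
  have hinv : Tendsto (fun i => Ring.inverse ((A (zs i)).comp R)) atTop
      (𝓝 (1 : F →L[ℝ] F)) := by
    have h := (NormedRing.inverse_continuousAt (1 : (F →L[ℝ] F)ˣ)).tendsto
    simp only [Units.val_one, Ring.inverse_one] at h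
    exact h.comp hlB
  have hunit : ∀ᶠ i in atTop, IsUnit ((A (zs i)).comp R) := by
    have h : {x : F →L[ℝ] F | IsUnit x} ∈ 𝓝 (1 : F →L[ℝ] F) :=
      Units.isOpen.mem_nhds isUnit_one
    exact hlB.eventually h
  have hinU : ∀ᶠ i in atTop, zs i ∈ U := hlz.eventually (hU.mem_nhds hz)
  have hlw : Tendsto w atTop (𝓝 ((pcl v).comp R)) := by
    have h : Tendsto (fun i => ((pcl (vs i)).comp R).comp (Ring.inverse ((A (zs i)).comp R)))
        atTop (𝓝 (((pcl v).comp R).comp (1 : F →L[ℝ] F))) :=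
      tendsto_clm_comp (tendsto_clm_comp hlp tendsto_const_nhds) hinv
    have h' : ((pcl v).comp R).comp (1 : F →L[ℝ] F) = (pcl v).comp R := by ext; simp
    rw [h'] at h
    refine h.congr' ?_
    filter_upwards [hunit, hinU] with i hi1 hi2
    rw [(hw i hi2).2]
    have h3 : ((A (zs i)).comp R) * Ring.inverse ((A (zs i)).comp R) = 1 :=
      Ring.mul_inverse_cancel _ hi1
    rw [ContinuousLinearMap.comp_assoc (w i), ContinuousLinearMap.comp_assoc (w i)]
    change (w i).comp (((A (zs i)).comp R) * Ring.inverse ((A (zs i)).comp R)) = w i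
    rw [h3]
    ext; simp
  set w₀ := (pcl v).comp R with hw₀
  have hw₀W : w₀ ∈ W := hW.mem_of_tendsto hlw (hinU.mono fun i hi => (hw i hi).1)
  have hveq : pcl v = w₀.comp (A z) := by
    refine tendsto_nhds_unique hlp ?_
    refine (tendsto_clm_comp hlw hlA).congr' ?_
    filter_upwards [hinU] with i hi
    exact (hw i hi).2.symm
  have hvprep : prep (w₀.comp (A z)) = v := by
    apply pinner_ext
    intro p
    rw [pinner_prep, ← hveq, pcl_apply]
  have hcont : Tendsto (fun y => prep (w₀.comp (A y))) (𝓝 z) (𝓝 v) := by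
    have h : Tendsto (fun y => w₀.comp (A y)) (𝓝 z) (𝓝 (w₀.comp (A z))) :=
      tendsto_clm_comp tendsto_const_nhds hA.tendsto
    have h' := (continuous_prep.tendsto (w₀.comp (A z))).comp h
    rwa [hvprep] at h'
  obtain ⟨δ, hδ, H⟩ := Metric.eventually_nhds_iff.1
    ((hcont.eventually (Metric.ball_mem_nhds v hε)).and (hU.mem_nhds hz))
  refine ⟨δ, hδ, fun z' hz' hd => ?_⟩
  obtain ⟨h3, h4⟩ := H hd
  exact ⟨_, h2 z' h4 hz' w₀ hw₀W _ (fun p => pinner_prep _ p), h3⟩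

/-- Submanifold case. -/
theorem innerNC_submanifold [FiniteDimensional ℝ E] {C : Set (ℝ × E)} (hC : IsClosed C) {c : ℕ}
    (h : IsC1SubmanifoldCodim c C) {z : ℝ × E} (hz : z ∈ frontier C) : InnerNC C z := by
  have : CompleteSpace E := FiniteDimensional.complete ℝ E
  obtain ⟨U, hU, hzU, f, hf, hs, hM⟩ := h z (hC.frontier_subset hz)
  have hfd : ∀ y ∈ U, fderivWithin ℝ f U y = fderiv ℝ f y := fun y hy =>
    fderivWithin_of_isOpen hU hy
  have hstrict : ∀ y ∈ U, HasStrictFDerivAt f (fderiv ℝ f y) y := fun y hy =>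
    (hf.contDiffAt (hU.mem_nhds hy)).hasStrictFDerivAt one_ne_zero
  have hiff : ∀ y ∈ U, (y ∈ C ↔ f y = 0) := by
    intro y hy
    have := Set.ext_iff.1 hM y
    simp only [mem_inter_iff, hy, and_true, mem_setOf_eq, true_and] at this
    exact this
  have hsurj : ∀ y ∈ U, Function.Surjective (fderiv ℝ f y) := fun y hy => hfd y hy ▸ hs y hy
  refine innerNC_of_local hU hzU (fderiv ℝ f)
    ((hf.continuousOn_fderiv_of_isOpen hU le_rfl).continuousAt (hU.mem_nhds hzU))
    (hsurj z hzU) Set.univ isClosed_univ ?_ ?_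
  · intro y hy hyC v hv
    have hrange := LinearMap.range_eq_top.2 (hsurj y hy)
    obtain ⟨R, hR⟩ := (fderiv ℝ f y).exists_rightInverse_of_surjective hrange
    have hfy : f y = 0 := (hiff y hy).1 hyC
    -- kernel vectors are tangent
    have hker : ∀ k, fderiv ℝ f y k = 0 → pinner v k ≤ 0 := by
      intro k hk
      have hst := hstrict y hy
      let k' : (fderiv ℝ f y).ker := ⟨k, hk⟩
      let γ : ℝ → ℝ × E := fun s =>
        hst.implicitFunction f (fderiv ℝ f y) hrange (f y) (s • k')
      have hl : HasDerivAt (fun s : ℝ => s • k') k' 0 := by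
        simpa using (hasDerivAt_id (0 : ℝ)).smul_const k'
      have hl0 : Tendsto (fun s : ℝ => s • k') (𝓝 0) (𝓝 0) := by
        simpa using hl.continuousAt.tendsto
      have hγ0 : γ 0 = y := by
        simp only [γ, zero_smul]
        exact hst.implicitFunction_apply_image hrange
      have hγ : HasDerivAt γ k 0 := by
        have h1 := (hst.to_implicitFunction hrange).hasFDerivAt
        have h2 := HasFDerivAt.comp_hasDerivAt_of_eq (0 : ℝ) h1 hl (by simp)
        exact h2
      refine pinner_tangent hv γ hγ0 hγ ?_
      apply nhdsWithin_le_nhds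
      have hmap := hst.map_implicitFunction_eq hrange
      have ht : Tendsto (fun s : ℝ => (f y, s • k')) (𝓝 0) (𝓝 (f y, 0)) :=
        tendsto_const_nhds.prodMk_nhds hl0
      have hγt : Tendsto γ (𝓝 0) (𝓝 y) := by
        have := hγ.continuousAt.tendsto
        rwa [hγ0] at this
      filter_upwards [ht.eventually hmap, hγt.eventually (hU.mem_nhds hy)] with s h3 h4
      refine (hiff _ h4).2 ?_
      exact h3.trans hfy
    have hker' : ∀ k, fderiv ℝ f y k = 0 → pcl v k = 0 := by
      intro k hk
      apply le_antisymm
      · rw [pcl_apply]; exact hker k hk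
      · have := hker (-k) (by simp [hk])
        rw [← pcl_apply, map_neg] at this
        linarith
    refine ⟨(pcl v).comp R, mem_univ _, fun p => ?_⟩
    have h0 := hker' (p - R (fderiv ℝ f y p)) (by
      have := congrArg (fun L : _ →L[ℝ] _ => L (fderiv ℝ f y p)) hR
      simp only [ContinuousLinearMap.comp_apply, ContinuousLinearMap.id_apply] at this
      rw [map_sub, this, sub_self])
    rw [map_sub, pcl_apply] at h0
    simp only [ContinuousLinearMap.comp_apply]
    linarith
  · intro y hy hyC w _ v hv ε hε
    have hfy : f y = 0 := (hiff y hy).1 (hC.frontier_subset hyC)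
    have hlit := (hstrict y hy).hasFDerivAt.isLittleO.def
      (c := ε / (‖w‖ + 1)) (by positivity)
    obtain ⟨δ, hδ, H⟩ := Metric.eventually_nhds_iff.1 (hlit.and (hU.mem_nhds hy))
    refine ⟨δ, hδ, fun y' hy'C hd => ?_⟩
    obtain ⟨h3, h4⟩ := H (by rwa [dist_eq_norm])
    rw [(hiff y' h4).1 hy'C, hfy, sub_zero, zero_sub, norm_neg] at h3
    rw [hv]
    have h5 : ‖w‖ * (ε / (‖w‖ + 1)) ≤ ε := by
      rw [mul_div_assoc', div_le_iff₀ (by positivity)]; nlinarith [norm_nonneg w]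
    calc w (fderiv ℝ f y (y' - y)) ≤ ‖w (fderiv ℝ f y (y' - y))‖ := le_abs_self _
      _ ≤ ‖w‖ * ‖fderiv ℝ f y (y' - y)‖ := w.le_opNorm _
      _ ≤ ‖w‖ * (ε / (‖w‖ + 1) * ‖y' - y‖) := by gcongr
      _ = ‖w‖ * (ε / (‖w‖ + 1)) * ‖y' - y‖ := by ring
      _ ≤ _ := by gcongr

theorem preconnected_dichotomy {X : Type*} [TopologicalSpace X] {P C : Set X}
    (hP : IsPreconnected P) (hd : ∀ y ∈ P, y ∉ frontier C) : P ⊆ C ∨ P ⊆ Cᶜ := by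
  by_contra hcon
  push Not at hcon
  obtain ⟨h1, h2⟩ := hcon
  obtain ⟨x, hx, hxC⟩ := Set.not_subset.1 h1
  obtain ⟨y, hy, hyC⟩ := Set.not_subset.1 h2
  have hyC : y ∈ C := not_not.1 hyC
  have hcov : P ⊆ interior C ∪ (closure C)ᶜ := by
    intro p hp
    by_cases hpi : p ∈ interior C
    · exact Or.inl hpi
    · exact Or.inr fun hpc => hd p hp ⟨hpc, hpi⟩
  have hyi : y ∈ interior C := by
    by_contra hn
    exact hd y hy ⟨subset_closure hyC, hn⟩
  have hxi : x ∈ (closure C)ᶜ := by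
    intro hn
    exact hd x hx ⟨hn, fun h => hxC (interior_subset h)⟩
  obtain ⟨q, -, hq1, hq2⟩ := hP _ _ isOpen_interior isClosed_closure.isOpen_compl hcov
    ⟨y, hy, hyi⟩ ⟨x, hx, hxi⟩
  exact hq2 (subset_closure (interior_subset hq1))

/-- Near a regular frontier point, a regular closed set is one side of the hypersurface. -/
theorem local_side [FiniteDimensional ℝ E] {C U : Set (ℝ × E)} (hC : IsClosed C)
    (hreg : C = closure (interior C)) (hU : IsOpen U) {z : ℝ × E} (hz : z ∈ U)
    (hzC : z ∈ frontier C) {φ : ℝ × E → ℝ} {φ' : ℝ × E →L[ℝ] ℝ}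
    (hφ : HasStrictFDerivAt φ φ' z) (hs : Function.Surjective φ')
    (hiff : ∀ y ∈ U, (y ∈ frontier C ↔ φ y = 0)) :
    ∃ V : Set (ℝ × E), IsOpen V ∧ z ∈ V ∧ V ⊆ U ∧
      ((∀ y ∈ V, y ∈ C ↔ φ y ≤ 0) ∨ (∀ y ∈ V, y ∈ C ↔ 0 ≤ φ y)) := by
  have : CompleteSpace E := FiniteDimensional.complete ℝ E
  have hrange := LinearMap.range_eq_top.2 hs
  set e := hφ.implicitToOpenPartialHomeomorph φ φ' hrange with he
  have hfst : ∀ y, (e y).1 = φ y := fun y => rfl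
  have hzs : z ∈ e.source := hφ.mem_implicitToOpenPartialHomeomorph_source hrange
  have hφz : φ z = 0 := (hiff z hz).1 hzC
  have hez : e z = (0, 0) := by
    rw [he, hφ.implicitToOpenPartialHomeomorph_self hrange, hφz]
  have hnb : ∀ᶠ p in 𝓝 ((0 : ℝ), (0 : φ'.ker)), p ∈ e.target ∧ e.symm p ∈ U := by
    rw [← hez]
    refine Filter.Eventually.and (e.open_target.mem_nhds (e.map_source hzs)) ?_
    exact (e.tendsto_symm hzs).eventually (hU.mem_nhds hz)
  obtain ⟨ρ, hρ, hB⟩ := Metric.eventually_nhds_iff_ball.1 hnb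
  set B := Metric.ball ((0 : ℝ), (0 : φ'.ker)) ρ with hBdef
  have hBconv : Convex ℝ B := convex_ball _ _
  set V := e.source ∩ e ⁻¹' B with hV
  have hVo : IsOpen V := e.isOpen_inter_preimage Metric.isOpen_ball
  have hzV : z ∈ V := ⟨hzs, by
    change e z ∈ B
    rw [hez]
    exact Metric.mem_ball_self hρ⟩
  have hVU : V ⊆ U := by
    rintro y ⟨h1, h2⟩
    have := (hB _ h2).2
    rwa [e.left_inv h1] at this
  have hpre : ∀ T : Set ℝ, Convex ℝ T → IsPreconnected (V ∩ φ ⁻¹' T) := by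
    intro T hT
    have hconv : Convex ℝ (B ∩ Prod.fst ⁻¹' T) :=
      hBconv.inter (hT.linear_preimage (LinearMap.fst ℝ ℝ φ'.ker))
    have himg : V ∩ φ ⁻¹' T = e.symm '' (B ∩ Prod.fst ⁻¹' T) := by
      ext y
      constructor
      · rintro ⟨⟨h1, h2⟩, h3⟩
        exact ⟨e y, ⟨h2, h3⟩, e.left_inv h1⟩
      · rintro ⟨p, ⟨h1, h2⟩, rfl⟩
        have hp := (hB p h1).1
        refine ⟨⟨e.map_target hp, ?_⟩, ?_⟩
        · change e (e.symm p) ∈ B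
          rwa [e.right_inv hp]
        · change φ (e.symm p) ∈ T
          rw [← hfst, e.right_inv hp]
          exact h2
    rw [himg]
    exact hconv.isPreconnected.image _
      (e.continuousOn_symm.mono fun p hp => (hB p hp.1).1)
  have hpos := preconnected_dichotomy (C := C) (hpre (Ioi 0) (convex_Ioi 0)) (by
    rintro y ⟨h1, h2⟩ h3
    have h2 : 0 < φ y := h2
    rw [(hiff y (hVU h1)).1 h3] at h2
    exact lt_irrefl _ h2)
  have hneg := preconnected_dichotomy (C := C) (hpre (Iio 0) (convex_Iio 0)) (by
    rintro y ⟨h1, h2⟩ h3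
    have h2 : φ y < 0 := h2
    rw [(hiff y (hVU h1)).1 h3] at h2
    exact lt_irrefl _ h2)
  have hzero : ∀ y ∈ V, φ y = 0 → y ∈ C := fun y hy h =>
    hC.frontier_subset ((hiff y (hVU hy)).2 h)
  refine ⟨V, hVo, hzV, hVU, ?_⟩
  rcases hpos with hpos | hpos <;> rcases hneg with hneg | hneg
  · exfalso
    refine hzC.2 (mem_interior.2 ⟨V, fun y hy => ?_, hVo, hzV⟩)
    rcases lt_trichotomy (φ y) 0 with h | h | h
    · exact hneg ⟨hy, h⟩
    · exact hzero y hy h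
    · exact hpos ⟨hy, h⟩
  · right
    intro y hy
    constructor
    · intro hyC
      by_contra h
      exact hneg ⟨hy, not_le.1 h⟩ hyC
    · intro h
      rcases h.eq_or_lt with h | h
      · exact hzero y hy h.symm
      · exact hpos ⟨hy, h⟩
  · left
    intro y hy
    constructor
    · intro hyC
      by_contra h
      exact hpos ⟨hy, not_le.1 h⟩ hyC
    · intro h
      rcases h.eq_or_lt with h | h
      · exact hzero y hy h
      · exact hneg ⟨hy, h⟩
  · exfalso
    have hzcl : z ∈ closure (interior C) := hreg ▸ hC.frontier_subset hzC
    obtain ⟨y, hy, hyi⟩ := mem_closure_iff.1 hzcl V hVo hzV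
    rcases lt_trichotomy (φ y) 0 with h | h | h
    · exact hneg ⟨hy, h⟩ (interior_subset hyi)
    · exact ((hiff y (hVU hy)).2 h).2 hyi
    · exact hpos ⟨hy, h⟩ (interior_subset hyi)

/-- Local sublevel set case. -/
theorem innerNC_sublevel [FiniteDimensional ℝ E] {C V : Set (ℝ × E)}
    (hV : IsOpen V) {z : ℝ × E} (hz : z ∈ V) {φ : ℝ × E → ℝ}
    (hφ : ContDiffOn ℝ 1 φ V) (hs : ∀ y ∈ V, Function.Surjective (fderiv ℝ φ y))
    (hiff : ∀ y ∈ V, (y ∈ C ↔ φ y ≤ 0)) (hfr : ∀ y ∈ V, y ∈ frontier C → φ y = 0) :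
    InnerNC C z := by
  have hd : ∀ y ∈ V, HasFDerivAt φ (fderiv ℝ φ y) y := fun y hy =>
    ((hφ.contDiffAt (hV.mem_nhds hy)).differentiableAt one_ne_zero).hasFDerivAt
  refine innerNC_of_local hV hz (fderiv ℝ φ)
    ((hφ.continuousOn_fderiv_of_isOpen hV le_rfl).continuousAt (hV.mem_nhds hz))
    (hs z hz) {w | 0 ≤ w 1} ?_ ?_ ?_
  · exact isClosed_le continuous_const (by fun_prop)
  · intro y hy hyC v hv
    have hneg : ∀ h, fderiv ℝ φ y h < 0 → pcl v h ≤ 0 := by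
      intro h hh
      rw [pcl_apply]
      have hl : HasDerivAt (fun s : ℝ => y + s • h) h 0 := by
        simpa using ((hasDerivAt_id (0 : ℝ)).smul_const h).const_add y
      refine pinner_tangent hv (fun s : ℝ => y + s • h) (by simp) hl ?_
      have hlt : Tendsto (fun s : ℝ => y + s • h) (𝓝 0) (𝓝 y) := by
        simpa using hl.continuousAt.tendsto
      have hcomp : HasDerivAt (fun s : ℝ => φ (y + s • h)) (fderiv ℝ φ y h) 0 :=
        HasFDerivAt.comp_hasDerivAt_of_eq (0 : ℝ) (hd y hy) hl (by simp)
      have hslope := hcomp.tendsto_slope_zero_right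
      filter_upwards [hslope.eventually (gt_mem_nhds hh), self_mem_nhdsWithin,
        nhdsWithin_le_nhds (hlt.eventually (hV.mem_nhds hy))] with s h1 h2 h3
      have h2 : 0 < s := h2
      refine (hiff _ h3).2 ?_
      simp only [zero_add, zero_smul, add_zero, smul_eq_mul] at h1
      have h4 := (hiff y hy).1 hyC
      have h5 : 0 < s⁻¹ := inv_pos.2 h2
      by_contra h6
      push Not at h6
      nlinarith [mul_nonneg h5.le (sub_nonneg.2 (h4.trans h6.le))]
    obtain ⟨k, hk⟩ := hs y hy 1
    have hvk : 0 ≤ pcl v k := by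
      have := hneg (-k) (by simp [hk])
      rw [map_neg] at this
      linarith
    have hker : ∀ h, fderiv ℝ φ y h = 0 → pcl v h ≤ 0 := by
      intro h hh
      apply le_of_forall_pos_le_add
      intro ε hε
      have := hneg (h - (ε / (pcl v k + 1)) • k) (by
        rw [map_sub, map_smul, hh, hk]
        simp only [smul_eq_mul, mul_one, zero_sub, neg_lt_zero]
        positivity)
      rw [map_sub, map_smul, smul_eq_mul] at this
      have h5 : ε / (pcl v k + 1) * pcl v k ≤ ε := by
        rw [div_mul_eq_mul_div, div_le_iff₀ (by positivity)]; nlinarith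
      linarith
    have hker' : ∀ h, fderiv ℝ φ y h = 0 → pcl v h = 0 := by
      intro h hh
      apply le_antisymm (hker h hh)
      have := hker (-h) (by simp [hh])
      rw [map_neg] at this
      linarith
    refine ⟨(pcl v k) • ContinuousLinearMap.id ℝ ℝ, by simpa using hvk, fun p => ?_⟩
    have := hker' (p - (fderiv ℝ φ y p) • k) (by simp [hk])
    rw [map_sub, map_smul, pcl_apply v p] at this
    simp only [smul_eq_mul] at this
    simp only [ContinuousLinearMap.smul_apply, ContinuousLinearMap.id_apply, smul_eq_mul]
    linarith
  · intro y hy hyC w hw v hv ε hε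
    have hw : 0 ≤ w 1 := hw
    have hlit := (hd y hy).isLittleO.def (c := ε / (w 1 + 1)) (by positivity)
    obtain ⟨δ, hδ, H⟩ := Metric.eventually_nhds_iff.1 (hlit.and (hV.mem_nhds hy))
    refine ⟨δ, hδ, fun y' hy'C hdd => ?_⟩
    obtain ⟨h3, h4⟩ := H (by rwa [dist_eq_norm])
    have h6 := (hiff y' h4).1 hy'C
    rw [hfr y hy hyC, sub_zero, Real.norm_eq_abs] at h3
    have h7 := neg_le_of_abs_le h3
    have h8 : fderiv ℝ φ y (y' - y) ≤ ε / (w 1 + 1) * ‖y' - y‖ := by linarith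
    have h9 : w (fderiv ℝ φ y (y' - y)) = w 1 * fderiv ℝ φ y (y' - y) := by
      have := w.map_smul (fderiv ℝ φ y (y' - y)) 1
      simp only [smul_eq_mul, mul_one] at this
      rw [this]; ring
    have h5 : w 1 * (ε / (w 1 + 1)) ≤ ε := by
      rw [mul_div_assoc', div_le_iff₀ (by positivity)]; nlinarith
    rw [hv, h9]
    calc w 1 * fderiv ℝ φ y (y' - y) ≤ w 1 * (ε / (w 1 + 1) * ‖y' - y‖) := by gcongr
      _ = w 1 * (ε / (w 1 + 1)) * ‖y' - y‖ := by ring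
      _ ≤ _ := by gcongr

/-- Full-dimensional case. -/
theorem innerNC_solid [FiniteDimensional ℝ E] {C : Set (ℝ × E)} (hC : IsClosed C)
    (hreg : C = closure (interior C)) (h : IsC1SubmanifoldCodim 1 (frontier C))
    {z : ℝ × E} (hz : z ∈ frontier C) : InnerNC C z := by
  obtain ⟨U, hU, hzU, f, hf, hs, hM⟩ := h z hz
  set φ : ℝ × E → ℝ := fun y => f y 0 with hφdef
  let π : EuclideanSpace ℝ (Fin 1) →L[ℝ] ℝ := EuclideanSpace.proj 0
  have hφ : ContDiffOn ℝ 1 φ U := π.contDiff.comp_contDiffOn hf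
  have hfderiv : ∀ y ∈ U, fderiv ℝ φ y = π.comp (fderiv ℝ f y) := by
    intro y hy
    have h1 := ((hf.contDiffAt (hU.mem_nhds hy)).differentiableAt one_ne_zero).hasFDerivAt
    exact (π.hasFDerivAt.comp y h1).fderiv
  have hsurj : ∀ y ∈ U, Function.Surjective (fderiv ℝ φ y) := by
    intro y hy r
    obtain ⟨k, hk⟩ := hs y hy (EuclideanSpace.single 0 r)
    rw [fderivWithin_of_isOpen hU hy] at hk
    refine ⟨k, ?_⟩
    rw [hfderiv y hy, ContinuousLinearMap.comp_apply, hk]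
    simp [π]
  have hiff : ∀ y ∈ U, (y ∈ frontier C ↔ φ y = 0) := by
    intro y hy
    have := Set.ext_iff.1 hM y
    simp only [mem_inter_iff, hy, and_true, mem_setOf_eq, true_and] at this
    rw [this]
    constructor
    · intro h0; simp [hφdef, h0]
    · intro h0
      ext i
      have : i = 0 := Subsingleton.elim _ _
      rw [this]
      simpa using h0
  have hst : HasStrictFDerivAt φ (fderiv ℝ φ z) z :=
    (hφ.contDiffAt (hU.mem_nhds hzU)).hasStrictFDerivAt one_ne_zero
  obtain ⟨V, hV, hzV, hVU, hcase⟩ := local_side hC hreg hU hzU hz hst (hsurj z hzU) hiff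
  rcases hcase with hc | hc
  · exact innerNC_sublevel hV hzV (hφ.mono hVU) (fun y hy => hsurj y (hVU hy)) hc
      (fun y hy h => (hiff y (hVU hy)).1 h)
  · refine innerNC_sublevel (φ := fun y => - φ y) hV hzV (hφ.mono hVU).neg (fun y hy => ?_)
      (fun y hy => ?_) (fun y hy h => ?_)
    · intro r
      obtain ⟨k, hk⟩ := hsurj y (hVU hy) (-r)
      refine ⟨k, ?_⟩
      rw [fderiv_fun_neg]
      simp [hk]
    · rw [hc y hy]; simp
    · simp [(hiff y (hVU hy)).1 h]

end Helpers
/-- Lemma: continuity of the (oriented) talweg: for a smooth sweeping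
process with bounded values, if `[a,b] ⊂ dom S` and `H_S` is Hausdorff–Pompeiu
continuous on `[a,b]`, then `φ↑` and `φ` are continuous on `[a,b]` (values in
`[0,+∞]`). -/
theorem statement11 {E : Type*} [NormedAddCommGroup E] [InnerProductSpace ℝ E]
    [FiniteDimensional ℝ E] (S : ℝ → Set E) (hS : SmoothSweepingProcess S)
    (hbv : BoundedValues S) (a b : ℝ) (hab : a ≤ b) (hdom : Icc a b ⊆ sdom S)
    (hHS : HPContinuousOn (HSmap S) (Icc a b)) :
    ContinuousOn (orientedTalweg S) (Icc a b) ∧ ContinuousOn (talweg S) (Icc a b) := by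
  obtain ⟨hcl, -, hcase⟩ := hS
  have hin : ∀ z ∈ frontier (sgraph S), InnerNC (sgraph S) z := by
    intro z hz
    rcases hcase with ⟨c, -, hc⟩ | ⟨hreg, hc⟩
    · exact innerNC_submanifold hcl hc hz
    · exact innerNC_solid hcl hreg hc hz
  constructor
  · exact gTal_continuousOn (g := fun x => x) continuous_id rfl (fun _ _ _ => rfl)
      (fun a ha => (abs_of_pos ha).le) hcl hin hbv hHS
  · exact gTal_continuousOn (g := fun x => |x|) continuous_abs abs_zero
      (fun r a hr => by rw [abs_mul, abs_of_nonneg hr])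
      (fun a _ => le_rfl) hcl hin hbv hHS
end

section
/- Let S : ℝ ⇒ ℝⁿ be a smooth sweeping process, t̄ ∈ dom(S) with t̄ < sup(dom(S)), and x̄ ∈ S(t̄). If ‖D*S(t̄,x̄)|⁺ > 0, then for any τ > t̄ and any orbit γ ∈ AC(S,[t̄,τ)) with γ(t̄) = x̄, there exists δ > 0 such that (t,γ(t)) ∈ ∂𝒮 for all t ∈ [t̄, t̄+δ). -/
open Set Metric Filter MeasureTheory
open scoped ENNReal RealInnerProductSpace Topology Pointwise

section Helpers

variable {E : Type*} [NormedAddCommGroup E] [InnerProductSpace ℝ E]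

lemma frechetNC_interior {C : Set E} {x v : E} (hx : x ∈ interior C)
    (hv : v ∈ frechetNC C x) : v = 0 := by
  by_contra hne
  have hvpos : 0 < ‖v‖ := norm_pos_iff.mpr hne
  obtain ⟨ρ, hρ, hball⟩ := Metric.isOpen_iff.mp isOpen_interior x hx
  obtain ⟨δ, hδ, h⟩ := hv (‖v‖ / 2) (by positivity)
  set m := min ρ δ with hm
  have hm0 : 0 < m := lt_min hρ hδ
  have key : ‖(m / 2 / ‖v‖) • v‖ = m / 2 := by
    rw [norm_smul, Real.norm_of_nonneg (by positivity)]
    field_simp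
  have h1 : x + (m / 2 / ‖v‖) • v ∈ C := by
    apply interior_subset
    apply hball
    rw [mem_ball, dist_eq_norm, add_sub_cancel_left, key]
    have := min_le_left ρ δ
    linarith
  have h2 := h _ h1 (by
    rw [add_sub_cancel_left, key]
    have := min_le_right ρ δ
    linarith)
  rw [add_sub_cancel_left, key, inner_smul_right, real_inner_self_eq_norm_sq] at h2
  have h3 : m / 2 / ‖v‖ * ‖v‖ ^ 2 = m / 2 * ‖v‖ := by field_simp
  rw [h3] at h2
  nlinarith

lemma limitingNC_interior {C : Set E} {x v : E} (hx : x ∈ interior C)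
    (hv : v ∈ limitingNC C x) : v = 0 := by
  obtain ⟨xs, vs, hxs, hvs, hx1, hv1⟩ := hv
  have h : ∀ᶠ i in atTop, vs i = 0 := by
    filter_upwards [hx1.eventually (isOpen_interior.mem_nhds hx)] with i hi
    exact frechetNC_interior hi (hvs i)
  exact tendsto_nhds_unique hv1 (tendsto_const_nhds.congr' (h.mono fun i hi => hi.symm))

/-- If one can move upward in time inside `C`, the time component of Fréchet normals is
nonpositive. -/
lemma frechetNCP_up {C : Set (ℝ × E)} {z v : ℝ × E} (hv : v ∈ frechetNCP C z) {ρ : ℝ}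
    (hρ : 0 < ρ) (hup : ∀ s, 0 < s → s < ρ → (z.1 + s, z.2) ∈ C) : v.1 ≤ 0 := by
  apply le_of_forall_pos_le_add
  intro ε hε
  obtain ⟨δ, hδ, h⟩ := hv ε hε
  set m := min ρ δ with hm
  have hm0 : 0 < m := lt_min hρ hδ
  have e : ((z.1 + m / 2, z.2) : ℝ × E) - z = (m / 2, 0) := by
    ext <;> simp
  have n : ‖((m / 2, 0) : ℝ × E)‖ = m / 2 := by
    simp [Prod.norm_def, abs_of_pos hm0]; positivity
  have h2 := h _ (hup (m / 2) (by positivity) (by have := min_le_left ρ δ; linarith)) (by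
    rw [e, n]; have := min_le_right ρ δ; linarith)
  rw [e, n] at h2
  simp only [pinner, inner_zero_right, add_zero] at h2
  have : (0:ℝ) < m / 2 := by positivity
  rw [zero_add]
  exact le_of_mul_le_mul_right h2 this

lemma frechetNCP_interior {C : Set (ℝ × E)} {z v : ℝ × E} (hv : v ∈ frechetNCP C z)
    (hz : z ∈ interior C) : v.1 ≤ 0 := by
  obtain ⟨ρ, hρ, hball⟩ := Metric.isOpen_iff.mp isOpen_interior z hz
  refine frechetNCP_up hv hρ fun s hs hs' => interior_subset (hball ?_)
  rw [mem_ball, Prod.dist_eq]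
  simp [abs_of_pos hs, hs', hρ]

lemma pinner_smul_right (p q : ℝ × E) (s : ℝ) : pinner p (s • q) = s * pinner p q := by
  simp [pinner, inner_smul_right]; ring

lemma pinner_add_right (p q r : ℝ × E) : pinner p (q + r) = pinner p q + pinner p r := by
  simp [pinner, inner_add_right]; ring

/-- Fréchet normals to a set containing a level hypersurface are nonpositive on its tangent
directions. -/
lemma frechetNCP_tangent {C : Set (ℝ × E)} {z v : ℝ × E} (hv : v ∈ frechetNCP C z)
    {U : Set (ℝ × E)} (hU : IsOpen U) (hz : z ∈ U) {φ : ℝ × E → ℝ}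
    (hφc : ContinuousOn φ U) {D : ℝ × E →L[ℝ] ℝ} (hD : HasFDerivAt φ D z)
    (hsub : ∀ y ∈ U, φ y = 0 → y ∈ C) (hφz : φ z = 0) {e w : ℝ × E} (he : D e = 1)
    (hw : D w = 0) : pinner v w ≤ 0 := by
  -- for all small ε, pinner v w ≤ ε * K
  have main : ∀ ε : ℝ, 0 < ε → ε < 1 →
      pinner v w ≤ ε * (‖w‖ + ‖e‖ + |pinner v e|) := by
    intro ε hε hε1
    obtain ⟨δ, hδ, h⟩ := hv ε hε
    -- curve derivative at 0
    have hder : ∀ c : ℝ, HasDerivAt (fun s : ℝ => φ (z + s • (w + c • e))) c 0 := by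
      intro c
      have h1 : HasDerivAt (fun s : ℝ => z + s • (w + c • e)) (w + c • e) 0 := by
        simpa using ((hasDerivAt_id (0:ℝ)).smul_const (w + c • e)).const_add z
      have h2 : HasFDerivAt φ D (z + (0:ℝ) • (w + c • e)) := by simpa using hD
      have h3 := h2.comp_hasDerivAt (0:ℝ) h1
      have h4 : D (w + c • e) = c := by simp [hw, he]
      rw [h4] at h3
      exact h3
    have hpos : ∀ᶠ s in 𝓝[>] (0:ℝ), 0 < φ (z + s • (w + ε • e)) := by
      have h1 := (hasDerivAt_iff_tendsto_slope_zero.mp (hder ε)).mono_left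
        (nhdsWithin_mono _ (fun x hx => ne_of_gt hx : Ioi (0:ℝ) ⊆ {0}ᶜ))
      filter_upwards [h1.eventually (lt_mem_nhds hε), self_mem_nhdsWithin] with s hs hs0
      simp [hφz] at hs
      have hs0 : 0 < s := hs0
      have := (mul_pos_iff_of_pos_left (inv_pos.mpr hs0)).mp hs
      simpa using this
    have hneg : ∀ᶠ s in 𝓝[>] (0:ℝ), φ (z + s • (w + (-ε) • e)) < 0 := by
      have h1 := (hasDerivAt_iff_tendsto_slope_zero.mp (hder (-ε))).mono_left
        (nhdsWithin_mono _ (fun x hx => ne_of_gt hx : Ioi (0:ℝ) ⊆ {0}ᶜ))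
      filter_upwards [h1.eventually (gt_mem_nhds (neg_lt_zero.mpr hε)),
        self_mem_nhdsWithin] with s hs hs0
      simp only [zero_add, zero_smul, add_zero, hφz, sub_zero, smul_eq_mul] at hs
      have hs0 : 0 < s := hs0
      by_contra hcon
      have := mul_nonneg (inv_pos.mpr hs0).le (not_lt.mp hcon)
      linarith
    obtain ⟨ρ, hρ, hball⟩ := Metric.isOpen_iff.mp hU z hz
    set K := ‖w‖ + ‖e‖ with hK
    have hK0 : 0 ≤ K := by positivity
    have hsmall : ∀ᶠ s in 𝓝[>] (0:ℝ), s * K < min ρ δ := by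
      have : Tendsto (fun s : ℝ => s * K) (𝓝 0) (𝓝 (0 * K)) := tendsto_id.mul_const K
      rw [zero_mul] at this
      exact (this.mono_left nhdsWithin_le_nhds).eventually (gt_mem_nhds (lt_min hρ hδ))
    obtain ⟨s, hs1, hs2, hs3, hs4⟩ :=
      (hpos.and (hneg.and (hsmall.and self_mem_nhdsWithin))).exists
    have hs0 : 0 < s := hs4
    have hnorm : ∀ c ∈ Icc (-ε) ε, ‖s • (w + c • e)‖ ≤ s * K := by
      intro c hc
      rw [norm_smul, Real.norm_of_nonneg hs0.le]
      gcongr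
      refine (norm_add_le _ _).trans ?_
      rw [norm_smul]
      have : ‖c‖ ≤ 1 := by rw [Real.norm_eq_abs, abs_le]; constructor <;> linarith [hc.1, hc.2]
      have := mul_le_mul_of_nonneg_right this (norm_nonneg e)
      linarith
    have hinU : ∀ c ∈ Icc (-ε) ε, z + s • (w + c • e) ∈ U := by
      intro c hc
      apply hball
      rw [mem_ball, dist_eq_norm, add_sub_cancel_left]
      exact (hnorm c hc).trans_lt (hs3.trans_le (min_le_left _ _))
    have hcont : ContinuousOn (fun c : ℝ => φ (z + s • (w + c • e))) (Icc (-ε) ε) :=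
      hφc.comp (by fun_prop) hinU
    obtain ⟨c, hc, hc0⟩ := intermediate_value_Icc (by linarith : -ε ≤ ε) hcont
      (show (0:ℝ) ∈ Icc (φ (z + s • (w + (-ε) • e))) (φ (z + s • (w + ε • e))) from
        ⟨hs2.le, hs1.le⟩)
    have h5 := h _ (hsub _ (hinU c hc) hc0) (by
      rw [add_sub_cancel_left]
      exact (hnorm c hc).trans_lt (hs3.trans_le (min_le_right _ _)))
    rw [add_sub_cancel_left, pinner_smul_right, pinner_add_right, pinner_smul_right] at h5
    have h6 : s * (pinner v w + c * pinner v e) ≤ s * (ε * K) :=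
      h5.trans ((mul_le_mul_of_nonneg_left (hnorm c hc) hε.le).trans (by linarith))
    have h7 := le_of_mul_le_mul_left h6 hs0
    have h8 : -(c * pinner v e) ≤ ε * |pinner v e| := by
      refine (neg_le_abs _).trans ?_
      rw [abs_mul]
      gcongr
      exact abs_le.mpr hc
    linarith
  have hlim : Tendsto (fun ε : ℝ => ε * (‖w‖ + ‖e‖ + |pinner v e|)) (𝓝[>] 0) (𝓝 0) := by
    have : Tendsto (fun ε : ℝ => ε * (‖w‖ + ‖e‖ + |pinner v e|)) (𝓝 0)
      (𝓝 (0 * (‖w‖ + ‖e‖ + |pinner v e|))) := tendsto_id.mul_const _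
    rw [zero_mul] at this
    exact this.mono_left nhdsWithin_le_nhds
  refine ge_of_tendsto hlim ?_
  filter_upwards [Ioo_mem_nhdsGT (zero_lt_one' ℝ)] with ε hε
  exact main ε hε.1 hε.2

/-- The time derivative of the local defining function does not vanish. -/
lemma time_deriv_ne_zero {C : Set (ℝ × E)} (hC : IsClosed C) {z v : ℝ × E}
    (hv : v ∈ limitingNCP C z) (hv1 : 0 < v.1)
    {U : Set (ℝ × E)} (hU : IsOpen U) (hz : z ∈ U) {φ : ℝ × E → ℝ}
    {D : ℝ × E → (ℝ × E →L[ℝ] ℝ)} (hD : ∀ y ∈ U, HasFDerivAt φ (D y) y)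
    (hDc : ContinuousOn D U) (hDz : D z ≠ 0)
    (hfr : ∀ y ∈ U, y ∈ frontier C ↔ φ y = 0) : D z (1, 0) ≠ 0 := by
  intro h0
  obtain ⟨zs, vs, hzs, hvs, hzt, hvt⟩ := hv
  obtain ⟨e, he⟩ : ∃ e, D z e ≠ 0 := by
    by_contra! hcon
    exact hDz (ContinuousLinearMap.ext hcon)
  have hDt : Tendsto (fun i => D (zs i)) atTop (𝓝 (D z)) :=
    (hDc.continuousAt (hU.mem_nhds hz)).tendsto.comp hzt
  have hDe : ∀ y : ℝ × E, Tendsto (fun i => D (zs i) y) atTop (𝓝 (D z y)) := fun y =>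
    ((ContinuousLinearMap.apply ℝ ℝ y).continuous.tendsto _).comp hDt
  have hvt1 : Tendsto (fun i => (vs i).1) atTop (𝓝 v.1) := (continuous_fst.tendsto _).comp hvt
  have hpe : Tendsto (fun i => pinner (vs i) e) atTop (𝓝 (pinner v e)) := by
    have : Continuous fun p : ℝ × E => pinner p e := by unfold pinner; fun_prop
    exact (this.tendsto _).comp hvt
  have hlim : Tendsto (fun i => (vs i).1 - D (zs i) (1, 0) / D (zs i) e * pinner (vs i) e)
      atTop (𝓝 (v.1 - D z (1, 0) / D z e * pinner v e)) :=
    hvt1.sub (((hDe _).div (hDe e) he).mul hpe)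
  rw [h0, zero_div, zero_mul, sub_zero] at hlim
  have : v.1 ≤ 0 := by
    refine le_of_tendsto hlim ?_
    filter_upwards [hzt.eventually (hU.mem_nhds hz), hvt1.eventually (lt_mem_nhds hv1),
      (hDe e).eventually_ne he] with i hiU hi1 hie
    have hfri : zs i ∈ frontier C := by
      rw [hC.frontier_eq]
      exact ⟨hzs i, fun hin => absurd (frechetNCP_interior (hvs i) hin) (not_le.mpr hi1)⟩
    have hφi := (hfr _ hiU).mp hfri
    have := frechetNCP_tangent (hvs i) hU hiU
      (fun y hy => (hD y hy).continuousAt.continuousWithinAt) (hD _ hiU)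
      (fun y hy h => hC.frontier_subset ((hfr y hy).mpr h)) hφi
      (e := (D (zs i) e)⁻¹ • e) (w := (1, 0) + (-(D (zs i) (1, 0) / D (zs i) e)) • e)
      (by simp [hie]) (by simp [hie])
    rw [pinner_add_right, pinner_smul_right] at this
    have h1 : pinner (vs i) ((1, 0) : ℝ × E) = (vs i).1 := by simp [pinner]
    rw [h1] at this
    linarith
  linarith

/-- Local description of the set below a hypersurface that is a graph over space. -/
lemma local_below {C : Set (ℝ × E)} (hC : IsClosed C) {z v : ℝ × E} 
    (hv : v ∈ limitingNCP C z) (hv1 : 0 < v.1)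
    {U : Set (ℝ × E)} (hU : IsOpen U) (hz : z ∈ U) {φ : ℝ × E → ℝ}
    {D : ℝ × E → (ℝ × E →L[ℝ] ℝ)} (hD : ∀ y ∈ U, HasFDerivAt φ (D y) y)
    (hDc : ContinuousOn D U) (hDz : 0 < D z (1, 0)) (hφz : φ z = 0)
    (hfr : ∀ y ∈ U, y ∈ frontier C ↔ φ y = 0) :
    ∃ η r : ℝ, 0 < η ∧ 0 < r ∧ (∀ t ∈ Icc (z.1 - η) (z.1 + η), ∀ x ∈ ball z.2 r,
        (t, x) ∈ U ∧ ((t, x) ∈ C → φ (t, x) ≤ 0)) ∧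
      (∀ x ∈ ball z.2 r, StrictMonoOn (fun t => φ (t, x)) (Icc (z.1 - η) (z.1 + η))) := by
  have hcD : ContinuousAt (fun y => D y (1, 0)) z :=
    ((ContinuousLinearMap.apply ℝ ℝ ((1, 0) : ℝ × E)).continuous.continuousAt).comp
      (hDc.continuousAt (hU.mem_nhds hz))
  have hev : ∀ᶠ y in 𝓝 z, y ∈ U ∧ 0 < D y (1, 0) :=
    Filter.Eventually.and (hU.mem_nhds hz : ∀ᶠ y in 𝓝 z, y ∈ U) (hcD.eventually (lt_mem_nhds hDz))
  obtain ⟨ρ, hρ, hball⟩ := Metric.eventually_nhds_iff_ball.mp hev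
  set η := ρ / 2 with hη
  have hη0 : 0 < η := by positivity
  have hmem : ∀ t ∈ Icc (z.1 - η) (z.1 + η), ∀ x ∈ ball z.2 ρ, (t, x) ∈ ball z ρ := by
    intro t ht x hx
    rw [mem_ball, Prod.dist_eq, max_lt_iff]
    refine ⟨?_, hx⟩
    rw [Real.dist_eq]
    refine lt_of_le_of_lt (abs_le.mpr ⟨?_, ?_⟩ : _ ≤ η) (by linarith) <;>
      simp only <;> linarith [ht.1, ht.2]
  have hderiv : ∀ t x, (t, x) ∈ U → HasDerivAt (fun t => φ (t, x)) (D (t, x) (1, 0)) t := by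
    intro t x htx
    exact (hD _ htx).comp_hasDerivAt t ((hasDerivAt_id t).prodMk (hasDerivAt_const t x))
  have hmono : ∀ x ∈ ball z.2 ρ,
      StrictMonoOn (fun t => φ (t, x)) (Icc (z.1 - η) (z.1 + η)) := by
    intro x hx
    apply strictMonoOn_of_deriv_pos (convex_Icc _ _)
    · intro t ht
      exact (hderiv t x (hball _ (hmem t ht x hx)).1).continuousAt.continuousWithinAt
    · intro t ht
      have ht' := interior_subset ht
      rw [(hderiv t x (hball _ (hmem t ht' x hx)).1).deriv]
      exact (hball _ (hmem t ht' x hx)).2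
  have htop : z.1 + η ∈ Icc (z.1 - η) (z.1 + η) := ⟨by linarith, le_rfl⟩
  have hmid : z.1 ∈ Icc (z.1 - η) (z.1 + η) := ⟨by linarith, by linarith⟩
  have hztop : 0 < φ (z.1 + η, z.2) := by
    have := hmono z.2 (mem_ball_self hρ) hmid htop (by linarith)
    simpa [hφz] using this
  have hcx : ContinuousAt (fun x => φ (z.1 + η, x)) z.2 := by
    have h1 := (hD _ (hball _ (hmem _ htop z.2 (mem_ball_self hρ))).1).continuousAt
    exact ContinuousAt.comp (g := φ) (f := fun x : E => (z.1 + η, x)) h1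
      (by fun_prop)
  obtain ⟨r', hr', hball'⟩ :=
    Metric.eventually_nhds_iff_ball.mp (hcx.eventually (lt_mem_nhds hztop))
  set r := min ρ r' with hr
  have hr0 : 0 < r := lt_min hρ hr'
  have hsub : ball z.2 r ⊆ ball z.2 ρ := ball_subset_ball (min_le_left _ _)
  refine ⟨η, r, hη0, hr0, fun t ht x hx => ⟨(hball _ (hmem t ht x (hsub hx))).1, ?_⟩,
    fun x hx => hmono x (hsub hx)⟩
  intro hpC
  by_contra hcon
  rw [not_le] at hcon
  set P : Set (ℝ × E) := {q | q.1 ∈ Icc (z.1 - η) (z.1 + η) ∧ q.2 ∈ ball z.2 r ∧ 0 < φ q} with hP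
  have htopP : ∀ x ∈ ball z.2 r, ((z.1 + η, x) : ℝ × E) ∈ P := fun x hx =>
    ⟨htop, hx, hball' x (ball_subset_ball (min_le_right _ _) hx)⟩
  have hPpre : IsPreconnected P := by
    have hvert : ∀ q ∈ P, IsPreconnected ((fun t => (t, q.2)) '' Icc q.1 (z.1 + η)) ∧
        ((fun t => (t, q.2)) '' Icc q.1 (z.1 + η)) ⊆ P := by
      intro q hq
      refine ⟨isPreconnected_Icc.image _ (by fun_prop), ?_⟩
      rintro _ ⟨t, ht, rfl⟩
      have htI : t ∈ Icc (z.1 - η) (z.1 + η) := ⟨hq.1.1.trans ht.1, ht.2⟩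
      refine ⟨htI, hq.2.1, hq.2.2.trans_le ?_⟩
      exact (hmono q.2 (hsub hq.2.1)).monotoneOn hq.1 htI ht.1
    have htopc : IsPreconnected ((fun x => ((z.1 + η, x) : ℝ × E)) '' ball z.2 r) :=
      (convex_ball _ _).isPreconnected.image _ (by fun_prop)
    apply isPreconnected_of_forall ((z.1 + η, z.2) : ℝ × E)
    intro q hq
    refine ⟨((fun t => (t, q.2)) '' Icc q.1 (z.1 + η)) ∪
      ((fun x => ((z.1 + η, x) : ℝ × E)) '' ball z.2 r), ?_, ?_, ?_, ?_⟩
    · refine union_subset (hvert q hq).2 ?_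
      rintro _ ⟨x, hx, rfl⟩
      exact htopP x hx
    · exact Or.inr ⟨z.2, mem_ball_self hr0, rfl⟩
    · exact Or.inl ⟨q.1, ⟨le_rfl, hq.1.2⟩, rfl⟩
    · exact IsPreconnected.union (z.1 + η, q.2) ⟨z.1 + η, ⟨hq.1.2, le_rfl⟩, rfl⟩
        ⟨q.2, hq.2.1, rfl⟩ (hvert q hq).1 htopc
  have hnot : ∀ t ∈ Icc (z.1 - η) (z.1 + η), ∀ x ∈ ball z.2 r, (t, x) ∈ C → φ (t, x) ≠ 0 →
      (t, x) ∈ interior C := by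
    intro t ht x hx hc hne
    by_contra hni
    apply hne
    rw [← hfr _ (hball _ (hmem t ht x (hsub hx))).1, hC.frontier_eq]
    exact ⟨hc, hni⟩
  have hPC : P ⊆ interior C := by
    apply hPpre.subset_left_of_subset_union isOpen_interior hC.isOpen_compl
    · exact disjoint_compl_right.mono_left interior_subset
    · intro q hq
      by_cases hqC : q ∈ C
      · exact Or.inl (hnot q.1 hq.1 q.2 hq.2.1 hqC hq.2.2.ne')
      · exact Or.inr hqC
    · exact ⟨(t, x), ⟨ht, hx, hcon⟩, hnot t ht x hx hpC hcon.ne'⟩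
  obtain ⟨zs, vs, hzs, hvs, hzt, hvt⟩ := hv
  have hz1 : Tendsto (fun i => (zs i).1) atTop (𝓝 z.1) := (continuous_fst.tendsto _).comp hzt
  have hz2 : Tendsto (fun i => (zs i).2) atTop (𝓝 z.2) := (continuous_snd.tendsto _).comp hzt
  have hvt1 : Tendsto (fun i => (vs i).1) atTop (𝓝 v.1) := (continuous_fst.tendsto _).comp hvt
  have : v.1 ≤ 0 := by
    refine le_of_tendsto hvt1 ?_
    filter_upwards [hz1.eventually (Ioo_mem_nhds (by linarith : z.1 - η < z.1)
      (by linarith : z.1 < z.1 + η)), hz2.eventually (ball_mem_nhds _ hr0)] with i hi1 hi2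
    have hiI : (zs i).1 ∈ Icc (z.1 - η) (z.1 + η) := ⟨hi1.1.le, hi1.2.le⟩
    rcases lt_or_ge (φ (zs i)) 0 with hneg | hnn
    · exact frechetNCP_interior (hvs i) (hnot _ hiI _ hi2 (hzs i) hneg.ne)
    · refine frechetNCP_up (hvs i) (sub_pos.mpr hi1.2) fun s hs hs' => interior_subset (hPC ?_)
      have hI : (zs i).1 + s ∈ Icc (z.1 - η) (z.1 + η) :=
        ⟨by linarith [hi1.1], by linarith⟩
      exact ⟨hI, hi2, hnn.trans_lt
        (hmono _ (hsub hi2) hiI hI (by linarith : (zs i).1 < (zs i).1 + s))⟩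
  linarith

lemma orbit_continuousOn {S : ℝ → Set E} {tb τ : ℝ} {γ γ' : ℝ → E}
    (horb : ACOrbit S (Ico tb τ) γ γ') : ContinuousOn γ (Ico tb τ) := by
  obtain ⟨-, hint, hftc, -⟩ := horb
  intro t ht
  obtain ⟨b, hb1, hb2⟩ := exists_between ht.2
  have htb : tb ∈ Ico tb τ := ⟨le_rfl, ht.1.trans_lt ht.2⟩
  have h1 : ContinuousOn (fun x => ∫ u in tb..x, γ' u) (uIcc tb b) := by
    apply intervalIntegral.continuousOn_primitive_interval
    rw [uIcc_of_le (ht.1.trans hb1.le)]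
    exact hint.mono_set (fun x hx => ⟨hx.1, hx.2.trans_lt hb2⟩)
  rw [uIcc_of_le (ht.1.trans hb1.le)] at h1
  have h2 : ContinuousOn γ (Icc tb b) := by
    refine (h1.const_add (γ tb) : ContinuousOn (fun x => γ tb + ∫ u in tb..x, γ' u) _).congr ?_
    intro x hx
    have := hftc tb htb x ⟨hx.1, hx.2.trans_lt hb2⟩
    simp only
    rw [← this]; abel
  refine (h2 t ⟨ht.1, hb1.le⟩).mono_of_mem_nhdsWithin ?_
  filter_upwards [self_mem_nhdsWithin, mem_nhdsWithin_of_mem_nhds (Iio_mem_nhds hb1)] with x hx hxb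
  exact ⟨hx.1, le_of_lt hxb⟩

/-- In the interior of the graph the orbit is constant. -/
lemma orbit_const {S : ℝ → Set E} {tb τ : ℝ} {γ γ' : ℝ → E}
    (horb : ACOrbit S (Ico tb τ) γ γ') {s t : ℝ} (hs : s ∈ Ico tb τ) (ht : t ∈ Ico tb τ)
    (hst : s ≤ t) (hin : ∀ u ∈ Ioc s t, (u, γ u) ∈ interior (sgraph S)) : γ t = γ s := by
  obtain ⟨-, hint, hftc, hae⟩ := horb
  rw [← sub_eq_zero, hftc s hs t ht]
  apply intervalIntegral.integral_zero_ae
  rw [ae_restrict_iff' measurableSet_Ico] at hae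
  filter_upwards [hae] with u hu hut
  rw [uIoc_of_le hst] at hut
  have h1 := hu ⟨hs.1.trans hut.1.le, hut.2.trans_lt ht.2⟩
  have h2 : γ u ∈ interior (S u) := by
    have hcont : Continuous (fun x : E => (u, x)) := by fun_prop
    rw [mem_interior]
    exact ⟨(fun x : E => (u, x)) ⁻¹' interior (sgraph S), 
      fun x hx => (interior_subset hx : (u, x) ∈ sgraph S),
      isOpen_interior.preimage hcont, hin u hut⟩
  exact neg_eq_zero.mp (limitingNC_interior h2 h1)

lemma orbit_boundary {S : ℝ → Set E} (hC : IsClosed (sgraph S)) {tb τ : ℝ} {γ γ' : ℝ → E}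
    (horb : ACOrbit S (Ico tb τ) γ γ') (hτ : tb < τ) {v : ℝ × E}
    (hv : v ∈ limitingNCP (sgraph S) (tb, γ tb)) (hv1 : 0 < v.1)
    {U : Set (ℝ × E)} (hU : IsOpen U) (hz : (tb, γ tb) ∈ U) {φ : ℝ × E → ℝ}
    {D : ℝ × E → (ℝ × E →L[ℝ] ℝ)} (hD : ∀ y ∈ U, HasFDerivAt φ (D y) y)
    (hDc : ContinuousOn D U) (hDz : 0 < D (tb, γ tb) (1, 0)) (hφz : φ (tb, γ tb) = 0)
    (hfr : ∀ y ∈ U, y ∈ frontier (sgraph S) ↔ φ y = 0) :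
    ∃ δ : ℝ, 0 < δ ∧ ∀ t ∈ Ico tb (tb + δ), (t, γ t) ∈ frontier (sgraph S) := by
  obtain ⟨η, r, hη, hr, hV, hmono⟩ := local_below hC hv hv1 hU hz hD hDc hDz hφz hfr
  simp only at hV hmono
  have hγc := orbit_continuousOn horb
  have hev : ∀ᶠ t in 𝓝[≥] tb, γ t ∈ ball (γ tb) r := by
    have h1 : Tendsto γ (𝓝[Ico tb τ] tb) (𝓝 (γ tb)) := hγc tb ⟨le_rfl, hτ⟩
    rw [nhdsWithin_Ico_eq_nhdsGE hτ] at h1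
    exact h1.eventually (ball_mem_nhds _ hr)
  obtain ⟨c, hc, hcsub⟩ := (mem_nhdsGE_iff_exists_Ico_subset' (by linarith : tb < tb + 1)).mp hev
  have hc : tb < c := hc
  refine ⟨min (c - tb) (min η (τ - tb)),
    lt_min (by linarith) (lt_min hη (by linarith)), ?_⟩
  intro t₁ ht₁
  have hb1 : t₁ < c := by have := min_le_left (c - tb) (min η (τ - tb)); linarith [ht₁.2]
  have hb2 : t₁ < tb + η := by
    have := (min_le_right (c - tb) (min η (τ - tb))).trans (min_le_left _ _); linarith [ht₁.2]
  have hb3 : t₁ < τ := by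
    have := (min_le_right (c - tb) (min η (τ - tb))).trans (min_le_right _ _); linarith [ht₁.2]
  have hI : ∀ t ∈ Icc tb t₁, t ∈ Icc (tb - η) (tb + η) ∧ γ t ∈ ball (γ tb) r ∧ t ∈ Ico tb τ := by
    intro t ht
    exact ⟨⟨by linarith [ht.1], by linarith [ht.2]⟩, hcsub ⟨ht.1, ht.2.trans_lt hb1⟩,
      ht.1, ht.2.trans_lt hb3⟩
  have ht₁I : t₁ ∈ Icc tb t₁ := ⟨ht₁.1, le_rfl⟩
  by_contra hcon
  have hUt : ∀ t ∈ Icc tb t₁, (t, γ t) ∈ U := fun t ht => (hV t (hI t ht).1 _ (hI t ht).2.1).1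
  have hcont : ContinuousOn (fun t => φ (t, γ t)) (Icc tb t₁) := by
    have hφc : ContinuousOn φ U := fun y hy => (hD y hy).continuousAt.continuousWithinAt
    refine hφc.comp (f := fun t => (t, γ t)) (continuousOn_id.prodMk (hγc.mono fun t ht => (hI t ht).2.2)) hUt
  set Z : Set ℝ := Icc tb t₁ ∩ (fun t => φ (t, γ t)) ⁻¹' {0} with hZ
  have hZc : IsCompact Z :=
    isCompact_Icc.of_isClosed_subset (hcont.preimage_isClosed_of_isClosed isClosed_Icc
      isClosed_singleton) inter_subset_left
  have hZn : Z.Nonempty := ⟨tb, ⟨le_rfl, ht₁.1⟩, hφz⟩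
  obtain ⟨t₀, ht₀, hmax⟩ := hZc.exists_isGreatest hZn
  have hne : t₀ ≠ t₁ := by
    rintro rfl
    exact hcon ((hfr _ (hUt _ ht₁I)).mpr ht₀.2)
  have hlt : t₀ < t₁ := lt_of_le_of_ne ht₀.1.2 hne
  have hγeq : γ t₁ = γ t₀ := by
    apply orbit_const horb (hI t₀ ht₀.1).2.2 (hI t₁ ht₁I).2.2 hlt.le
    intro u hu
    have huI : u ∈ Icc tb t₁ := ⟨ht₀.1.1.trans hu.1.le, hu.2⟩
    by_contra hni
    have : (u, γ u) ∈ frontier (sgraph S) := by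
      rw [hC.frontier_eq]
      exact ⟨horb.1 u (hI u huI).2.2, hni⟩
    have h0 := (hfr _ (hUt u huI)).mp this
    have := hmax ⟨huI, h0⟩
    linarith [hu.1]
  have h1 := hmono (γ t₀) (hI t₀ ht₀.1).2.1 (hI t₀ ht₀.1).1 (hI t₁ ht₁I).1 hlt
  have h2 := (hV t₁ (hI t₁ ht₁I).1 _ (hI t₁ ht₁I).2.1).2 (horb.1 t₁ (hI t₁ ht₁I).2.2)
  have h3 : φ (t₀, γ t₀) = 0 := ht₀.2
  rw [hγeq] at h2
  simp only at h1
  linarith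

lemma submanifold_interior_empty {c : ℕ} (hc : 1 ≤ c) {M : Set (ℝ × E)}
    (hM : IsC1SubmanifoldCodim c M) : interior M = ∅ := by
  rw [eq_empty_iff_forall_notMem]
  intro z hz
  obtain ⟨U, hU, hzU, f, -, hsurj, hMU⟩ := hM z (interior_subset hz)
  have hf : f =ᶠ[𝓝 z] fun _ => 0 := by
    filter_upwards [hU.mem_nhds hzU, isOpen_interior.mem_nhds hz] with y hyU hyM
    have : y ∈ M ∩ U := ⟨interior_subset hyM, hyU⟩
    rw [hMU] at this
    exact this.2
  have h0 : fderivWithin ℝ f U z = 0 := by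
    rw [fderivWithin_of_isOpen hU hzU, hf.fderiv_eq]
    simp
  obtain ⟨y, hy⟩ := hsurj z hzU (EuclideanSpace.single ⟨0, hc⟩ 1)
  rw [h0] at hy
  have := congrArg (fun w : EuclideanSpace ℝ (Fin c) => w ⟨0, hc⟩) hy
  simp at this

end Helpers

/-- Proposition, geometric facts (b): if `‖D*S(t̄,x̄)|⁺ > 0`, then any
orbit issued from `(t̄,x̄)` stays on the boundary `∂𝒮` for a short time. -/
theorem statement14 {E : Type*} [NormedAddCommGroup E] [InnerProductSpace ℝ E]
    [FiniteDimensional ℝ E] (S : ℝ → Set E) (hS : SmoothSweepingProcess S)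
    (tb : ℝ) (htb : tb ∈ sdom S) (hsup : ∃ t ∈ sdom S, tb < t)
    (xb : E) (hxb : xb ∈ S tb) (hpos : 0 < asymMod S tb xb)
    (τ : ℝ) (hτ : tb < τ) (γ γ' : ℝ → E)
    (horb : ACOrbit S (Ico tb τ) γ γ') (hγ : γ tb = xb) :
    ∃ δ : ℝ, 0 < δ ∧ ∀ t ∈ Ico tb (tb + δ), (t, γ t) ∈ frontier (sgraph S) := by
  obtain ⟨hC, -, hcase⟩ := hS
  rcases hcase with ⟨c, hc, hM⟩ | ⟨-, hM⟩
  · refine ⟨τ - tb, by linarith, fun t ht => ?_⟩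
    rw [hC.frontier_eq, submanifold_interior_empty hc hM, sdiff_empty]
    exact horb.1 t ⟨ht.1, by linarith [ht.2]⟩
  · subst hγ
    obtain ⟨v, hv, hv1⟩ : ∃ v ∈ limitingNCP (sgraph S) (tb, γ tb), 0 < v.1 := by
      unfold asymMod at hpos
      simp only [lt_iSup_iff] at hpos
      obtain ⟨u, -, a, ha, hapos⟩ := hpos
      exact ⟨(a, -u), ha, ENNReal.ofReal_pos.mp hapos⟩
    have hzfr : (tb, γ tb) ∈ frontier (sgraph S) := by
      rw [hC.frontier_eq]
      refine ⟨hxb, fun hin => ?_⟩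
      obtain ⟨zs, vs, hzs, hvs, hzt, hvt⟩ := hv
      have : v.1 ≤ 0 := by
        refine le_of_tendsto ((continuous_fst.tendsto _).comp hvt) ?_
        filter_upwards [hzt.eventually (isOpen_interior.mem_nhds hin)] with i hi
        exact frechetNCP_interior (hvs i) hi
      linarith
    obtain ⟨U, hU, hzU, f, hf, hsurj, hMU⟩ := hM _ hzfr
    let L : EuclideanSpace ℝ (Fin 1) →L[ℝ] ℝ := EuclideanSpace.proj (0 : Fin 1)
    have hL : ∀ w : EuclideanSpace ℝ (Fin 1), L w = 0 ↔ w = 0 := by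
      intro w
      constructor
      · intro h
        ext i
        rw [Subsingleton.elim i 0]
        exact h
      · rintro rfl
        simp
    let D : ℝ × E → (ℝ × E →L[ℝ] ℝ) := fun y => L.comp (fderivWithin ℝ f U y)
    have hD : ∀ y ∈ U, HasFDerivAt (fun y => L (f y)) (D y) y := by
      intro y hy
      have h1 : HasFDerivAt f (fderivWithin ℝ f U y) y :=
        ((hf.differentiableOn (by norm_num)) y hy).hasFDerivWithinAt.hasFDerivAt (hU.mem_nhds hy)
      exact L.hasFDerivAt.comp y h1
    have hDc : ContinuousOn D U := by
      have h1 : ContinuousOn (fun y => fderivWithin ℝ f U y) U :=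
        hf.continuousOn_fderivWithin hU.uniqueDiffOn (by norm_num)
      exact continuousOn_const.clm_comp h1
    have hDz : D (tb, γ tb) ≠ 0 := by
      intro h
      obtain ⟨y, hy⟩ := hsurj _ hzU (EuclideanSpace.single 0 1)
      have h2 : L (fderivWithin ℝ f U (tb, γ tb) y) = 0 := by
        change D (tb, γ tb) y = 0
        rw [h]; rfl
      rw [hy] at h2
      simp [L] at h2
    have hfr : ∀ y ∈ U, y ∈ frontier (sgraph S) ↔ L (f y) = 0 := by
      intro y hy
      rw [hL]
      constructor
      · intro h
        have : y ∈ frontier (sgraph S) ∩ U := ⟨h, hy⟩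
        rw [hMU] at this
        exact this.2
      · intro h
        have : y ∈ {y ∈ U | f y = 0} := ⟨hy, h⟩
        rw [← hMU] at this
        exact this.1
    have hφz := (hfr _ hzU).mp hzfr
    have hne := time_deriv_ne_zero hC hv hv1 hU hzU hD hDc hDz hfr
    rcases lt_or_gt_of_ne hne with hneg | hpos'
    · exact orbit_boundary hC horb hτ hv hv1 hU hzU (φ := fun y => -L (f y))
        (D := fun y => -D y) (fun y hy => (hD y hy).neg) hDc.neg (by simpa using hneg)
        (by simpa using hφz) (fun y hy => by rw [hfr y hy, neg_eq_zero])
    · exact orbit_boundary hC horb hτ hv hv1 hU hzU hD hDc hpos' hφz hfr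
end

section
/- Let S : ℝ ⇒ ℝⁿ be a smooth sweeping process, t̄ ∈ dom(S) with t̄ < sup(dom(S)), and x̄ ∈ S(t̄). If int(𝒮) is nonempty and N_𝒮(t̄,x̄) = ℝ₊·(α,u) is the ray generated by a vector (α,u) with α < 0, then there exists δ > 0 such that x̄ ∈ S(t) for all t ∈ [t̄, t̄+δ). -/
open Set Metric Filter MeasureTheory
open scoped ENNReal RealInnerProductSpace Topology Pointwise

/-- Local connectedness of the two sides of a `C¹` hypersurface. -/
lemma exists_two_sides {F : Type*} [NormedAddCommGroup F] [NormedSpace ℝ F] [CompleteSpace F]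
    (g : F → ℝ) (g' : F →L[ℝ] ℝ) (z : F) (hg : HasStrictFDerivAt g g' z)
    (hr : g'.range = ⊤) (W : Set F) (hW : W ∈ 𝓝 z) :
    ∃ V : Set F, IsOpen V ∧ z ∈ V ∧ V ⊆ W ∧ IsPreconnected (V ∩ {y | 0 < g y}) ∧
      IsPreconnected (V ∩ {y | g y < 0}) := by
  obtain ⟨φ, hφ, hz⟩ : ∃ φ : OpenPartialHomeomorph F (ℝ × g'.ker),
      (∀ y, (φ y).1 = g y) ∧ z ∈ φ.source :=
    ⟨hg.implicitToOpenPartialHomeomorph g g' hr, fun y => by simp,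
      hg.mem_implicitToOpenPartialHomeomorph_source hr⟩
  have hzt : φ z ∈ φ.target := φ.map_source hz
  have h1 : φ.target ∩ φ.symm ⁻¹' W ∈ 𝓝 (φ z) := by
    refine inter_mem (φ.open_target.mem_nhds hzt) ?_
    exact (φ.tendsto_symm hz) hW
  obtain ⟨r, hr0, hball⟩ := Metric.mem_nhds_iff.1 h1
  have hconv : ∀ s : Set ℝ, Convex ℝ s →
      IsPreconnected ((φ.source ∩ φ ⁻¹' ball (φ z) r) ∩ {y | g y ∈ s}) := by
    intro s hs
    have hc : Convex ℝ (ball (φ z) r ∩ Prod.fst ⁻¹' s) :=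
      (convex_ball _ _).inter (hs.linear_preimage (LinearMap.fst ℝ ℝ g'.ker))
    have hsub : ball (φ z) r ∩ Prod.fst ⁻¹' s ⊆ φ.target :=
      fun q hq => (hball hq.1).1
    have him := hc.isPreconnected.image φ.symm (φ.symm.continuousOn.mono hsub)
    rw [φ.symm_image_eq_source_inter_preimage hsub] at him
    convert him using 1
    ext y
    simp only [mem_inter_iff, mem_preimage, mem_setOf_eq, hφ]
    tauto
  refine ⟨φ.source ∩ φ ⁻¹' ball (φ z) r, φ.isOpen_inter_preimage isOpen_ball,
    ⟨hz, mem_ball_self hr0⟩, ?_, hconv (Ioi 0) (convex_Ioi 0), hconv (Iio 0) (convex_Iio 0)⟩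
  rintro y ⟨hy, hyb⟩
  have := (hball hyb).2
  simpa [φ.left_inv hy] using this

/-- If locally `G = {g ≤ 0}` and the normal cone is a ray with negative time component, then
one may move forward in time inside `G`. -/
lemma forward_of_side {E : Type*} [NormedAddCommGroup E] [InnerProductSpace ℝ E]
    [FiniteDimensional ℝ E] (G : Set (ℝ × E)) (z : ℝ × E) (hzG : z ∈ G)
    (g : ℝ × E → ℝ) (g' : ℝ × E →L[ℝ] ℝ) (hg : HasFDerivAt g g' z) (hg0 : g z = 0)
    (hne : g' ≠ 0) (V : Set (ℝ × E)) (hV : V ∈ 𝓝 z)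
    (hneg : ∀ y ∈ V, g y < 0 → y ∈ G) (hpos : ∀ y ∈ V, 0 < g y → y ∉ G)
    (α : ℝ) (u : E) (hα : α < 0)
    (hray : limitingNCP G z ⊆ {p : ℝ × E | ∃ c : ℝ, 0 ≤ c ∧ p = c • ((α, u) : ℝ × E)}) :
    ∃ δ : ℝ, 0 < δ ∧ ∀ s : ℝ, 0 ≤ s → s < δ → z + s • ((1, 0) : ℝ × E) ∈ G := by
  have : CompleteSpace E := FiniteDimensional.complete ℝ E
  set w : E := (InnerProductSpace.toDual ℝ E).symm (g'.comp (ContinuousLinearMap.inr ℝ ℝ E)) with hw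
  have hwi : ∀ x : E, ⟪w, x⟫ = g' (0, x) := fun x => by
    simp [hw]
  set v : ℝ × E := (g' (1, 0), w) with hv
  have hvi : ∀ y, pinner v y = g' y := by
    rintro ⟨a, x⟩
    have h1 : ((a, x) : ℝ × E) = a • (1, 0) + (0, x) := by simp
    rw [h1, map_add, map_smul]
    simp [pinner, hv, hwi, mul_comm]
  have hvN : v ∈ limitingNCP G z := by
    refine ⟨fun _ => z, fun _ => v, fun _ => hzG, fun _ => ?_, tendsto_const_nhds,
      tendsto_const_nhds⟩
    intro ε hε
    have h1 := (hasFDerivAt_iff_isLittleO.1 hg).def hε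
    obtain ⟨δ, hδ, hb⟩ := Metric.eventually_nhds_iff.1 (h1.and hV)
    refine ⟨δ, hδ, fun y hy hyd => ?_⟩
    obtain ⟨h2, h3⟩ := hb (y := y) (by rwa [dist_eq_norm])
    have h4 : g y ≤ 0 := by
      by_contra h
      exact hpos y h3 (not_le.1 h) hy
    rw [hvi]
    rw [hg0, Real.norm_eq_abs] at h2
    have := (abs_le.1 h2).1
    linarith
  obtain ⟨c, hc, hvc⟩ := hray hvN
  have hc0 : c ≠ 0 := by
    rintro rfl
    apply hne
    ext1
    · ext; simpa using congrArg Prod.fst hvc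
    · ext x
      have h0 : w = 0 := by simpa using congrArg Prod.snd hvc
      have := hwi x
      rw [h0, inner_zero_left] at this
      simpa using this.symm
  have hd : g' (1, 0) < 0 := by
    have h1 : g' (1, 0) = c * α := by simpa using congrArg Prod.fst hvc
    rw [h1]
    exact mul_neg_of_pos_of_neg (lt_of_le_of_ne hc hc0.symm) hα
  have hline : HasDerivAt (fun s : ℝ => z + s • ((1, 0) : ℝ × E)) ((1, 0) : ℝ × E) 0 := by
    simpa using ((hasDerivAt_id (0 : ℝ)).smul_const ((1, 0) : ℝ × E)).const_add z
  have hcomp : HasDerivAt (fun s : ℝ => g (z + s • ((1, 0) : ℝ × E))) (g' (1, 0)) 0 := by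
    have hg1 : HasFDerivAt g g' (z + (0 : ℝ) • ((1, 0) : ℝ × E)) := by simpa using hg
    exact hg1.comp_hasDerivAt 0 hline
  have hVs : ∀ᶠ s in 𝓝 (0 : ℝ), z + s • ((1, 0) : ℝ × E) ∈ V :=
    hline.continuousAt.eventually_mem (by simpa using hV)
  have hlt : ∀ᶠ s in 𝓝 (0 : ℝ), 0 < s → g (z + s • ((1, 0) : ℝ × E)) < 0 := by
    have h1 := (hasDerivAt_iff_isLittleO.1 hcomp).def (c := -g' (1, 0) / 2) (by linarith)
    filter_upwards [h1] with s hs hs0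
    simp only [zero_smul, add_zero, hg0, sub_zero, smul_eq_mul, Real.norm_eq_abs,
      abs_of_pos hs0] at hs
    have := (abs_le.1 hs).2
    nlinarith
  obtain ⟨δ, hδ, hb⟩ := Metric.eventually_nhds_iff.1 (hVs.and hlt)
  refine ⟨δ, hδ, fun s hs0 hsd => ?_⟩
  rcases hs0.eq_or_lt with rfl | hs0
  · simpa using hzG
  obtain ⟨h1, h2⟩ := hb (y := s) (by simpa [abs_of_pos hs0] using hsd)
  exact hneg _ h1 (h2 hs0)

/-- Proposition, geometric facts (c): if `int 𝒮 ≠ ∅` and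
`N_𝒮(t̄,x̄) = ℝ₊·(α,u)` with `α < 0`, then `x̄ ∈ S(t)` for all `t ∈ [t̄, t̄+δ)` for
some `δ > 0`. -/
theorem statement15 {E : Type*} [NormedAddCommGroup E] [InnerProductSpace ℝ E]
    [FiniteDimensional ℝ E] (S : ℝ → Set E) (hS : SmoothSweepingProcess S)
    (tb : ℝ) (htb : tb ∈ sdom S) (hsup : ∃ t ∈ sdom S, tb < t)
    (xb : E) (hxb : xb ∈ S tb)
    (hint : (interior (sgraph S)).Nonempty)
    (α : ℝ) (u : E) (hα : α < 0)
    (hray : limitingNCP (sgraph S) (tb, xb) =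
      {p : ℝ × E | ∃ c : ℝ, 0 ≤ c ∧ p = c • ((α, u) : ℝ × E)}) :
    ∃ δ : ℝ, 0 < δ ∧ ∀ t ∈ Ico tb (tb + δ), xb ∈ S t := by
  set G := sgraph S with hG
  obtain ⟨hcl, -, hS⟩ := hS
  have hzG : (tb, xb) ∈ G := hxb
  suffices h : ∃ δ : ℝ, 0 < δ ∧ ∀ s : ℝ, 0 ≤ s → s < δ →
      ((tb, xb) : ℝ × E) + s • ((1, 0) : ℝ × E) ∈ G by
    obtain ⟨δ, hδ, h⟩ := h
    refine ⟨δ, hδ, fun t ht => ?_⟩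
    have := h (t - tb) (by linarith [ht.1]) (by linarith [ht.2])
    simpa [hG, sgraph] using this
  rcases hS with ⟨c, hc, hM⟩ | ⟨hreg, hM⟩
  · exfalso
    obtain ⟨y, hy⟩ := hint
    obtain ⟨U, hU, hyU, f, -, hsurj, heq⟩ := hM y (interior_subset hy)
    have h0 : f =ᶠ[𝓝 y] fun _ => 0 := by
      filter_upwards [hU.mem_nhds hyU, isOpen_interior.mem_nhds hy] with x hx hx2
      have : x ∈ G ∩ U := ⟨interior_subset hx2, hx⟩
      rw [heq] at this
      exact this.2
    have h1 : fderivWithin ℝ f U y = 0 := by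
      rw [fderivWithin_of_isOpen hU hyU, h0.fderiv_eq]
      simp
    obtain ⟨a, ha⟩ := hsurj y hyU (EuclideanSpace.single ⟨0, hc⟩ 1)
    rw [h1] at ha
    have := congrArg (fun q => q ⟨0, hc⟩) ha
    simp at this
  by_cases hin : ((tb, xb) : ℝ × E) ∈ interior G
  · have hline : ContinuousAt (fun s : ℝ => ((tb, xb) : ℝ × E) + s • ((1, 0) : ℝ × E)) 0 := by
      fun_prop
    have hev := hline.eventually_mem (s := interior G)
      (by simpa using mem_interior_iff_mem_nhds.1 hin)
    obtain ⟨δ, hδ, hb⟩ := Metric.eventually_nhds_iff.1 hev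
    exact ⟨δ, hδ, fun s hs0 hsd => interior_subset
      (hb (y := s) (by simpa [abs_of_nonneg hs0] using hsd))⟩
  have hfr : ((tb, xb) : ℝ × E) ∈ frontier G := ⟨subset_closure hzG, hin⟩
  obtain ⟨U, hU, hzU, f, hf, hsurj, heq⟩ := hM _ hfr
  set z : ℝ × E := (tb, xb) with hz
  have hfs : HasStrictFDerivAt f (fderivWithin ℝ f U z) z := by
    rw [fderivWithin_of_isOpen hU hzU]
    exact (hf.contDiffAt (hU.mem_nhds hzU)).hasStrictFDerivAt one_ne_zero
  set P : EuclideanSpace ℝ (Fin 1) →L[ℝ] ℝ := EuclideanSpace.proj 0 with hP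
  have hgs : HasStrictFDerivAt (fun y => f y 0) (P.comp (fderivWithin ℝ f U z)) z :=
    P.hasStrictFDerivAt.comp z hfs
  have hsg : Function.Surjective (P.comp (fderivWithin ℝ f U z)) := by
    intro a
    obtain ⟨b, hb⟩ := hsurj z hzU (EuclideanSpace.single 0 a)
    exact ⟨b, by simp [hP, hb]⟩
  have hzero : ∀ y ∈ U, (f y 0 = 0 ↔ y ∈ frontier G) := by
    intro y hy
    have h1 : y ∈ frontier G ∩ U ↔ y ∈ {y ∈ U | f y = 0} := by rw [heq]
    have h2 : f y = 0 ↔ f y 0 = 0 := by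
      constructor
      · intro h; simp [h]
      · intro h; ext i; fin_cases i; simpa using h
    simp only [mem_inter_iff, hy, and_true, mem_setOf_eq, true_and] at h1
    rw [h1, h2]
  generalize hg' : P.comp (fderivWithin ℝ f U z) = g' at hgs hsg
  generalize hgdef : (fun y => f y 0) = g at hgs
  have hzero' : ∀ y ∈ U, (g y = 0 ↔ y ∈ frontier G) := by
    intro y hy
    rw [← hgdef]
    exact hzero y hy
  have hg0 : g z = 0 := (hzero' z hzU).2 hfr
  have hne : g' ≠ 0 := by
    rintro rfl
    obtain ⟨b, hb⟩ := hsg 1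
    simp at hb
  have : CompleteSpace E := FiniteDimensional.complete ℝ E
  obtain ⟨V, hVo, hzV, hVU, hcp, hcn⟩ := exists_two_sides g g' z hgs
    (LinearMap.range_eq_top.2 hsg) U (hU.mem_nhds hzU)
  have hdisj : Disjoint (interior G) Gᶜ :=
    disjoint_compl_right.mono_left interior_subset
  have hcov : ∀ y ∈ V, g y ≠ 0 → y ∈ interior G ∪ Gᶜ := by
    intro y hy hgy
    by_cases hyG : y ∈ G
    · left
      by_contra h
      exact hgy ((hzero' y (hVU hy)).2 ⟨subset_closure hyG, h⟩)
    · exact Or.inr hyG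
  have hp := hcp.subset_or_subset isOpen_interior hcl.isOpen_compl hdisj
    (fun y hy => hcov y hy.1 (ne_of_gt hy.2))
  have hn := hcn.subset_or_subset isOpen_interior hcl.isOpen_compl hdisj
    (fun y hy => hcov y hy.1 (ne_of_lt hy.2))
  have hVn := hVo.mem_nhds hzV
  rcases hp with hp | hp <;> rcases hn with hn | hn
  · exfalso
    apply hin
    rw [mem_interior_iff_mem_nhds]
    filter_upwards [hVn] with y hy
    rcases lt_trichotomy (g y) 0 with h | h | h
    · exact interior_subset (hn ⟨hy, h⟩)
    · exact hcl.frontier_subset ((hzero' y (hVU hy)).1 h)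
    · exact interior_subset (hp ⟨hy, h⟩)
  · refine forward_of_side G z hzG (fun y => -g y) (-g') hgs.hasFDerivAt.neg (by simp [hg0])
      (neg_ne_zero.2 hne) V hVn ?_ ?_ α u hα hray.le
    · intro y hy h
      exact interior_subset (hp ⟨hy, by simpa using h⟩)
    · intro y hy h
      exact hn ⟨hy, by simpa using h⟩
  · exact forward_of_side G z hzG g g' hgs.hasFDerivAt hg0 hne V hVn
      (fun y hy h => interior_subset (hn ⟨hy, h⟩)) (fun y hy h => hp ⟨hy, h⟩) α u hα hray.le
  · exfalso
    have hzc : z ∈ closure (interior G) := by rw [← hreg]; exact hzG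
    obtain ⟨y, hyV, hyi⟩ := mem_closure_iff.1 hzc V hVo hzV
    rcases lt_trichotomy (g y) 0 with h | h | h
    · exact hn ⟨hyV, h⟩ (interior_subset hyi)
    · exact ((hzero' y (hVU hyV)).1 h).2 hyi
    · exact hp ⟨hyV, h⟩ (interior_subset hyi)
end

section
/- Let S : ℝ ⇒ ℝⁿ be a smooth sweeping process and γ ∈ AC(S,[a,b)) an orbit of the sweeping process defined by S. Then ‖γ̇(t)‖ = ‖D*S(t,γ(t))|⁺ for every t ∈ [a,b) at which γ is differentiable, −γ̇(t) ∈ N_{S(t)}(γ(t)), and ‖D*S(t,γ(t))|⁺ is finite. -/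
open Set Metric Filter MeasureTheory
open scoped ENNReal RealInnerProductSpace Topology Pointwise

/-- Metric-regularity type lemma: near `z` one can move along `h` while prescribing `f`. -/
lemma aux_move {F Y : Type*} [NormedAddCommGroup F] [NormedSpace ℝ F] [CompleteSpace F]
    [NormedAddCommGroup Y] [NormedSpace ℝ Y] [CompleteSpace Y]
    {f : F → Y} {A : F →L[ℝ] Y} {z : F} (hf : HasStrictFDerivAt f A z)
    (hA : Function.Surjective A) (h : F) (ε : ℝ) (hε : 0 < ε) :
    ∃ δ : ℝ, 0 < δ ∧ ∀ y : F, ‖y - z‖ < δ → ∀ s : ℝ, 0 ≤ s → s < δ →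
      ∃ y' : F, f y' = f y + s • A h ∧ ‖y' - (y + s • h)‖ ≤ ε * s := by
  have hr : A.range = ⊤ := LinearMap.range_eq_top.2 hA
  set R := A.nonlinearRightInverseOfSurjective hr with hR
  have hK : 0 < (R.nnnorm : ℝ) := by
    exact_mod_cast A.nonlinearRightInverseOfSurjective_nnnorm_pos hr
  set K : ℝ := (R.nnnorm : ℝ) with hKdef
  have hden : 0 < ‖h‖ + ε := by positivity
  set c : ℝ := K⁻¹ * ε / (‖h‖ + ε) with hc
  have hcpos : 0 < c := by positivity
  have hce : c * (‖h‖ + ε) = K⁻¹ * ε := by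
    rw [hc]; field_simp
  obtain ⟨s0, hs0, hap⟩ := hf.approximates_deriv_on_nhds (c := ⟨c, hcpos.le⟩) (Or.inr hcpos)
  obtain ⟨ρ, hρ, hball⟩ := Metric.mem_nhds_iff.1 hs0
  have hden2 : 0 < 1 + ‖h‖ + ε := by positivity
  refine ⟨ρ / (1 + ‖h‖ + ε), by positivity, fun y hy s hs hsδ => ?_⟩
  rw [lt_div_iff₀ hden2] at hy hsδ
  have hy0 := norm_nonneg (y - z)
  have hh0 := norm_nonneg h
  set δ := ρ / (1 + ‖h‖ + ε) with hδ
  have hδρ : δ * (1 + ‖h‖ + ε) = ρ := by rw [hδ]; field_simp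
  have hys : ‖y - z‖ < δ := by rw [hδ, lt_div_iff₀ hden2]; exact hy
  have hss : s < δ := by rw [hδ, lt_div_iff₀ hden2]; exact hsδ
  have hsub : closedBall (y + s • h) (ε * s) ⊆ s0 := by
    intro w hw
    apply hball
    rw [mem_closedBall, dist_eq_norm] at hw
    rw [mem_ball, dist_eq_norm]
    have h1 : w - z = (w - (y + s • h)) + (y - z) + s • h := by abel
    have h2 : ‖s • h‖ = s * ‖h‖ := by rw [norm_smul, Real.norm_of_nonneg hs]
    have h3 := norm_add₃_le (a := w - (y + s • h)) (b := y - z) (c := s • h)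
    rw [h1]
    nlinarith [mul_nonneg (sub_nonneg.2 hss.le) hh0, mul_nonneg (sub_nonneg.2 hss.le) hε.le]
  have hsurj := hap.surjOn_closedBall_of_nonlinearRightInverse R
    (b := y + s • h) (mul_nonneg hε.le hs) hsub
  have hmem : f y + s • A h ∈ closedBall (f (y + s • h)) (((R.nnnorm : ℝ)⁻¹ - c) * (ε * s)) := by
    have hyin : y ∈ s0 := hball (by
      rw [mem_ball, dist_eq_norm]; nlinarith [mul_nonneg hy0 hh0, mul_nonneg hy0 hε.le])
    have hbin : y + s • h ∈ s0 := hsub (mem_closedBall_self (mul_nonneg hε.le hs))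
    have := hap (y + s • h) hbin y hyin
    rw [mem_closedBall, dist_comm, dist_eq_norm]
    have e1 : y + s • h - y = s • h := by abel
    rw [e1, map_smul, norm_smul, Real.norm_of_nonneg hs] at this
    have e2 : f (y + s • h) - (f y + s • A h) = f (y + s • h) - f y - s • A h := by abel
    rw [e2]
    refine this.trans ?_
    change c * (s * ‖h‖) ≤ (K⁻¹ - c) * (ε * s)
    have : c * (s * ‖h‖) = s * (c * (‖h‖ + ε)) - c * (ε * s) := by ring
    rw [this, hce]; apply le_of_eq; ring
  obtain ⟨y', hy', hfy'⟩ := hsurj hmem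
  refine ⟨y', hfy', ?_⟩
  rwa [mem_closedBall, dist_eq_norm] at hy'

/-- Limiting normals to a set locally of the form `f ∈ P`. -/
lemma aux_normal {F Y : Type*} [NormedAddCommGroup F] [NormedSpace ℝ F] [CompleteSpace F]
    [NormedAddCommGroup Y] [NormedSpace ℝ Y] [CompleteSpace Y]
    {f : F → Y} {A : F →L[ℝ] Y} {z : F} (hf : HasStrictFDerivAt f A z)
    (hA : Function.Surjective A) (P : Set Y)
    (hadd : ∀ p ∈ P, ∀ q ∈ P, p + q ∈ P) (hsmul : ∀ s : ℝ, 0 < s → ∀ p ∈ P, s • p ∈ P)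
    (C : Set F) (hC : ∀ᶠ y in 𝓝 z, (y ∈ C ↔ f y ∈ P))
    (ys : ℕ → F) (φs : ℕ → F →L[ℝ] ℝ) (φ : F →L[ℝ] ℝ) (hys : ∀ i, ys i ∈ C)
    (hfr : ∀ i, ∀ ε : ℝ, 0 < ε → ∃ δ : ℝ, 0 < δ ∧
      ∀ y ∈ C, ‖y - ys i‖ < δ → φs i (y - ys i) ≤ ε * ‖y - ys i‖)
    (hyl : Tendsto ys atTop (𝓝 z)) (hφl : Tendsto φs atTop (𝓝 φ))
    (h : F) (hh : A h ∈ P) : φ h ≤ 0 := by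
  have key : ∀ ε : ℝ, 0 < ε → ∀ᶠ i in atTop, φs i h ≤ ‖φs i‖ * ε := by
    intro ε hε
    obtain ⟨δ, hδ, hmove⟩ := aux_move hf hA h ε hε
    obtain ⟨ρ, hρ, hball⟩ := Metric.eventually_nhds_iff.1 hC
    have hev : ∀ᶠ i in atTop, dist (ys i) z < min δ (ρ / 2) :=
      (Metric.tendsto_nhds.1 hyl) _ (by positivity)
    filter_upwards [hev] with i hi
    have hi1 : ‖ys i - z‖ < δ := by
      rw [← dist_eq_norm]; exact hi.trans_le (min_le_left _ _)
    have hi2 : dist (ys i) z < ρ / 2 := hi.trans_le (min_le_right _ _)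
    have hfy : f (ys i) ∈ P := (hball (by linarith)).1 (hys i)
    have hM : 0 < ‖h‖ + ε := by positivity
    have step : ∀ η : ℝ, 0 < η → φs i h ≤ ‖φs i‖ * ε + η * (‖h‖ + ε) := by
      intro η hη
      obtain ⟨δ', hδ', hfr'⟩ := hfr i η hη
      obtain ⟨s, hs0, hs1⟩ : ∃ s : ℝ, 0 < s ∧
          s < min δ (min (δ' / (‖h‖ + ε)) (ρ / 2 / (‖h‖ + ε))) :=
        exists_between (by positivity)
      obtain ⟨hsa, hsb⟩ := lt_min_iff.1 hs1
      obtain ⟨hsb, hsc⟩ := lt_min_iff.1 hsb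
      rw [lt_div_iff₀ hM] at hsb hsc
      obtain ⟨y', hfy', hy'⟩ := hmove (ys i) hi1 s hs0.le hsa
      have hd : ‖y' - ys i‖ ≤ s * (‖h‖ + ε) := by
        have e : y' - ys i = (y' - (ys i + s • h)) + s • h := by abel
        rw [e]
        refine (norm_add_le _ _).trans ?_
        rw [norm_smul, Real.norm_of_nonneg hs0.le]; linarith
      have hy'C : y' ∈ C := by
        refine (hball ?_).2 ?_
        · have := dist_triangle y' (ys i) z
          rw [dist_eq_norm y' (ys i)] at this
          linarith
        · rw [hfy']; exact hadd _ hfy _ (hsmul s hs0 _ hh)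
      have h1 := hfr' y' hy'C (by linarith)
      have e : y' - ys i = (y' - (ys i + s • h)) + s • h := by abel
      have h2 : φs i (y' - ys i) = φs i (y' - (ys i + s • h)) + s * φs i h := by
        conv_lhs => rw [e]
        rw [map_add, map_smul, smul_eq_mul]
      have h3 : |φs i (y' - (ys i + s • h))| ≤ ‖φs i‖ * (ε * s) :=
        ((φs i).le_opNorm _).trans (mul_le_mul_of_nonneg_left hy' (norm_nonneg _))
      have h4 := (abs_le.1 h3).1
      have h5 : η * ‖y' - ys i‖ ≤ η * (s * (‖h‖ + ε)) := mul_le_mul_of_nonneg_left hd hη.le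
      have h6 : s * φs i h ≤ s * (‖φs i‖ * ε + η * (‖h‖ + ε)) := by nlinarith
      exact le_of_mul_le_mul_left h6 hs0
    refine le_of_forall_pos_le_add fun κ hκ => ?_
    have := step (κ / (‖h‖ + ε)) (by positivity)
    rwa [div_mul_cancel₀ _ hM.ne'] at this
  have lim1 : Tendsto (fun i => φs i h) atTop (𝓝 (φ h)) :=
    ((ContinuousLinearMap.apply ℝ ℝ h).continuous.tendsto φ).comp hφl
  have key2 : ∀ ε : ℝ, 0 < ε → φ h ≤ ‖φ‖ * ε := fun ε hε =>
    le_of_tendsto_of_tendsto lim1 (hφl.norm.mul_const ε) (key ε hε)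
  refine le_of_forall_pos_le_add fun κ hκ => ?_
  have h1 := key2 (κ / (‖φ‖ + 1)) (by positivity)
  have h2 : ‖φ‖ * (κ / (‖φ‖ + 1)) ≤ κ := by
    rw [mul_div_assoc', div_le_iff₀ (by positivity)]; nlinarith [norm_nonneg φ]
  linarith

/-- A preconnected set avoiding the frontier of `C` and meeting `C` lies in `C`. -/
lemma aux_preconn {X : Type*} [TopologicalSpace X] {s C : Set X} (hs : IsPreconnected s)
    (hd : ∀ x ∈ s, x ∉ frontier C) {p q : X} (hp : p ∈ s) (hq : q ∈ s) (hpC : p ∈ C) :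
    q ∈ C := by
  have hint : ∀ x ∈ s, x ∈ closure C → x ∈ interior C := fun x hx hxc => by
    by_contra hni
    exact hd x hx ⟨hxc, hni⟩
  have hsub : s ⊆ interior C ∪ (closure C)ᶜ := fun x hx => by
    by_cases hxc : x ∈ closure C
    · exact Or.inl (hint x hx hxc)
    · exact Or.inr hxc
  have hdis : Disjoint (interior C) (closure C)ᶜ :=
    disjoint_compl_right.mono_left interior_subset_closure
  exact interior_subset (hs.subset_left_of_subset_union isOpen_interior
    isClosed_closure.isOpen_compl hdis hsub ⟨p, hp, hint p hp (subset_closure hpC)⟩ hq)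

/-- The functional on `ℝ × E` associated with the pairing. -/
noncomputable def auxFun {E : Type*} [NormedAddCommGroup E] [InnerProductSpace ℝ E]
    (p : ℝ × E) : (ℝ × E) →L[ℝ] ℝ :=
  p.1 • ContinuousLinearMap.fst ℝ ℝ E + (innerSL ℝ p.2).comp (ContinuousLinearMap.snd ℝ ℝ E)

lemma auxFun_apply {E : Type*} [NormedAddCommGroup E] [InnerProductSpace ℝ E]
    (p q : ℝ × E) : auxFun p q = pinner p q := by
  simp [auxFun, pinner]

lemma auxFun_continuous {E : Type*} [NormedAddCommGroup E] [InnerProductSpace ℝ E] :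
    Continuous (auxFun : ℝ × E → ((ℝ × E) →L[ℝ] ℝ)) := by
  unfold auxFun
  have h1 : Continuous fun p : ℝ × E => (innerSL ℝ p.2 : E →L[ℝ] ℝ) :=
    (innerSL ℝ).continuous.comp continuous_snd
  exact (continuous_fst.smul continuous_const).add (h1.clm_comp continuous_const)

/-- Limiting normals in `E`. -/
lemma aux_limitingNC {E Y : Type*} [NormedAddCommGroup E] [InnerProductSpace ℝ E]
    [CompleteSpace E] [NormedAddCommGroup Y] [NormedSpace ℝ Y] [CompleteSpace Y]
    {f : E → Y} {A : E →L[ℝ] Y} {x : E} (hf : HasStrictFDerivAt f A x)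
    (hA : Function.Surjective A) (P : Set Y)
    (hadd : ∀ p ∈ P, ∀ q ∈ P, p + q ∈ P) (hsmul : ∀ s : ℝ, 0 < s → ∀ p ∈ P, s • p ∈ P)
    (C : Set E) (hC : ∀ᶠ y in 𝓝 x, (y ∈ C ↔ f y ∈ P)) (w : E) (hw : w ∈ limitingNC C x)
    (h : E) (hh : A h ∈ P) : ⟪w, h⟫ ≤ 0 := by
  obtain ⟨xs, vs, h1, h2, h3, h4⟩ := hw
  exact aux_normal hf hA P hadd hsmul C hC xs (fun i => innerSL ℝ (vs i)) (innerSL ℝ w) h1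
    (fun i => h2 i) h3 (((innerSL ℝ).continuous.tendsto w).comp h4) h hh

/-- Limiting normals in `ℝ × E`. -/
lemma aux_limitingNCP {E Y : Type*} [NormedAddCommGroup E] [InnerProductSpace ℝ E]
    [CompleteSpace E] [NormedAddCommGroup Y] [NormedSpace ℝ Y] [CompleteSpace Y]
    {f : ℝ × E → Y} {A : (ℝ × E) →L[ℝ] Y} {x : ℝ × E} (hf : HasStrictFDerivAt f A x)
    (hA : Function.Surjective A) (P : Set Y)
    (hadd : ∀ p ∈ P, ∀ q ∈ P, p + q ∈ P) (hsmul : ∀ s : ℝ, 0 < s → ∀ p ∈ P, s • p ∈ P)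
    (C : Set (ℝ × E)) (hC : ∀ᶠ y in 𝓝 x, (y ∈ C ↔ f y ∈ P)) (w : ℝ × E)
    (hw : w ∈ limitingNCP C x)
    (h : ℝ × E) (hh : A h ∈ P) : pinner w h ≤ 0 := by
  obtain ⟨xs, vs, h1, h2, h3, h4⟩ := hw
  have := aux_normal hf hA P hadd hsmul C hC xs (fun i => auxFun (vs i)) (auxFun w) h1
    (fun i ε hε => by simpa only [auxFun_apply] using h2 i ε hε) h3
    ((auxFun_continuous.tendsto w).comp h4) h hh
  rwa [auxFun_apply] at this

/-- Normals at interior points vanish. -/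
lemma aux_interior {E : Type*} [NormedAddCommGroup E] [InnerProductSpace ℝ E]
    [CompleteSpace E] (C : Set E) (x w : E) (hC : C ∈ 𝓝 x) (hw : w ∈ limitingNC C x) :
    w = 0 := by
  have h := aux_limitingNC (Y := PUnit.{1}) (f := fun _ => 0) (A := 0) (x := x)
    (hasStrictFDerivAt_const _ _) (fun y => ⟨0, Subsingleton.elim _ _⟩) univ (by simp) (by simp)
    C (by filter_upwards [hC] with y hy; simpa using hy) w hw w (by simp)
  rw [real_inner_self_eq_norm_sq] at h
  exact norm_eq_zero.1 (by nlinarith [norm_nonneg w])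

/-- The first-order condition: the velocity satisfies the linearised constraint. -/
lemma aux_tangent {E Y : Type*} [NormedAddCommGroup E] [InnerProductSpace ℝ E]
    [NormedAddCommGroup Y] [NormedSpace ℝ Y]
    {f : ℝ × E → Y} {A : (ℝ × E) →L[ℝ] Y} {t : ℝ} {γ : ℝ → E} {v : E}
    (hf : HasFDerivAt f A (t, γ t)) (hγ : HasDerivAt γ v t) (hz : f (t, γ t) = 0) :
    Tendsto (fun s => (s - t)⁻¹ • f (s, γ s)) (𝓝[>] t) (𝓝 (A (1, v))) := by
  have h1 : HasDerivAt (fun s => (s, γ s)) (1, v) t := (hasDerivAt_id t).prodMk hγ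
  have h2 : HasDerivAt (fun s => f (s, γ s)) (A (1, v)) t := hf.comp_hasDerivAt t h1
  have h3 := (hasDerivAt_iff_tendsto_slope.1 h2).mono_left
    (nhdsWithin_mono t (fun s (hs : t < s) => (ne_of_gt hs : s ≠ t)))
  refine h3.congr fun s => ?_
  simp [slope, hz]

/-- The local form of the statement. -/
lemma aux_local {E Y : Type*} [NormedAddCommGroup E] [InnerProductSpace ℝ E]
    [FiniteDimensional ℝ E] [NormedAddCommGroup Y] [NormedSpace ℝ Y] [FiniteDimensional ℝ Y]
    (S : ℝ → Set E) (t : ℝ) (x v : E)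
    {f : ℝ × E → Y} {A : (ℝ × E) →L[ℝ] Y} (hf : HasStrictFDerivAt f A (t, x))
    (hA : Function.Surjective A) (hz : f (t, x) = 0) (P : Set Y) (h0 : (0 : Y) ∈ P)
    (hadd : ∀ p ∈ P, ∀ q ∈ P, p + q ∈ P) (hsmul : ∀ s : ℝ, 0 < s → ∀ p ∈ P, s • p ∈ P)
    (hC : ∀ᶠ y in 𝓝 (t, x), (y ∈ sgraph S ↔ f y ∈ P))
    (htan : A (1, v) ∈ P) (hv : v ≠ 0 → A (1, v) = 0)
    (hnv : -v ∈ limitingNC (S t) x) : (‖v‖₊ : ℝ≥0∞) = asymMod S t x := by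
  have : CompleteSpace E := FiniteDimensional.complete ℝ E
  have : CompleteSpace Y := FiniteDimensional.complete ℝ Y
  have hnn : (‖v‖₊ : ℝ≥0∞) = ENNReal.ofReal ‖v‖ := (ofReal_norm v).symm
  apply le_antisymm
  · by_cases hv0 : v = 0
    · simp [hv0]
    have hA1 := hv hv0
    have hsplit : ∀ (s : ℝ) (y : E), A (s, y) = A (0, y - s • v) := by
      intro s y
      have e : (s, y) = s • ((1 : ℝ), v) + ((0 : ℝ), y - s • v) := by ext <;> simp
      rw [e, map_add, map_smul, hA1]; simp
    set Ax : E →L[ℝ] Y := A.comp (ContinuousLinearMap.inr ℝ ℝ E) with hAx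
    have hAxa : ∀ y, Ax y = A (0, y) := fun y => by simp [hAx]
    have hAxs : Function.Surjective Ax := fun p => by
      obtain ⟨⟨s, y⟩, hy⟩ := hA p
      exact ⟨y - s • v, by rw [hAxa, ← hsplit, hy]⟩
    have hfx : HasStrictFDerivAt (fun y => f (t, y)) Ax x := by
      have h1 : HasStrictFDerivAt (fun y : E => (t, y)) (ContinuousLinearMap.inr ℝ ℝ E) x :=
        (hasStrictFDerivAt_const t x).prodMk (hasStrictFDerivAt_id x)
      exact HasStrictFDerivAt.comp x hf h1
    have hCx : ∀ᶠ y in 𝓝 x, (y ∈ S t ↔ f (t, y) ∈ P) := by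
      have hc : Tendsto (fun y : E => (t, y)) (𝓝 x) (𝓝 (t, x)) :=
        (Continuous.prodMk_right t).tendsto x
      exact hc.eventually hC
    have hneg : ∀ h, Ax h ∈ P → ⟪-v, h⟫ ≤ 0 := fun h hh =>
      aux_limitingNC hfx hAxs P hadd hsmul (S t) hCx (-v) hnv h hh
    obtain ⟨R, hR⟩ := ContinuousLinearMap.exists_rightInverse_of_surjective Ax
      (LinearMap.range_eq_top.2 hAxs)
    have hRa : ∀ p, Ax (R p) = p := fun p => by
      have := congrArg (fun L : Y →L[ℝ] Y => L p) hR
      simpa using this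
    have hvpos : 0 < ‖v‖ := norm_pos_iff.2 hv0
    -- the candidate normal
    have hmem : (‖v‖, -(‖v‖⁻¹ • v)) ∈ frechetNCP (sgraph S) (t, x) := by
      intro ε hε
      have hq : 0 < ε / (‖R‖ + 1) := by positivity
      have hlin := (hf.hasFDerivAt.isLittleO.def hq).and hC
      obtain ⟨δ, hδ, hball⟩ := Metric.eventually_nhds_iff.1 hlin
      refine ⟨δ, hδ, fun y hy hyδ => ?_⟩
      obtain ⟨hb1, hb2⟩ := hball (y := y) (by rwa [dist_eq_norm])
      have hfy := hb2.1 hy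
      set r : Y := f y - f (t, x) - A (y - (t, x)) with hr
      set s := y.1 - t with hs
      set k := y.2 - x with hk
      have hyz : y - (t, x) = (s, k) := rfl
      set h := k - s • v with hh
      have hAh : Ax h = f y - r := by
        rw [hAxa, ← hsplit, ← hyz, hr, hz]; abel
      have h1 := hneg (h + R r) (by rw [map_add, hRa, hAh]; simpa using hfy)
      have h2 : pinner (‖v‖, -(‖v‖⁻¹ • v)) (y - (t, x)) = ‖v‖⁻¹ * ⟪-v, h⟫ := by
        rw [hyz, pinner, hh]
        simp only [inner_neg_left, inner_sub_right, inner_smul_left, inner_smul_right,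
          real_inner_self_eq_norm_sq, RCLike.conj_to_real]
        field_simp
        ring
      have h3 : |⟪v, R r⟫| ≤ ‖v‖ * (‖R‖ * ‖r‖) :=
        (abs_real_inner_le_norm _ _).trans
          (mul_le_mul_of_nonneg_left (R.le_opNorm r) (norm_nonneg _))
      have h4 := (abs_le.1 h3).2
      have h5 : ⟪-v, h⟫ ≤ ‖v‖ * (‖R‖ * ‖r‖) := by
        rw [inner_add_right, inner_neg_left v (R r)] at h1; linarith
      rw [h2]
      have h6 : ‖v‖⁻¹ * ⟪-v, h⟫ ≤ ‖R‖ * ‖r‖ := by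
        rw [inv_mul_le_iff₀ hvpos]; exact h5
      have h7 : ‖R‖ * ‖r‖ ≤ ‖R‖ * (ε / (‖R‖ + 1) * ‖y - (t, x)‖) :=
        mul_le_mul_of_nonneg_left hb1 (norm_nonneg _)
      have h8 : ‖R‖ * (ε / (‖R‖ + 1)) ≤ ε := by
        rw [mul_div_assoc', div_le_iff₀ (by positivity)]; nlinarith [norm_nonneg R]
      calc _ ≤ _ := h6
        _ ≤ _ := h7
        _ = ‖R‖ * (ε / (‖R‖ + 1)) * ‖y - (t, x)‖ := by ring
        _ ≤ _ := mul_le_mul_of_nonneg_right h8 (norm_nonneg _)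
    have hzS : (t, x) ∈ sgraph S := hC.self_of_nhds.2 (by rw [hz]; exact h0)
    have hcod : ‖v‖ ∈ coderiv S t x (‖v‖⁻¹ • v) :=
      ⟨fun _ => (t, x), fun _ => (‖v‖, -(‖v‖⁻¹ • v)), fun _ => hzS, fun _ => hmem,
        tendsto_const_nhds, tendsto_const_nhds⟩
    have hn1 : ‖‖v‖⁻¹ • v‖ ≤ 1 := by
      rw [norm_smul, norm_inv, norm_norm, inv_mul_cancel₀ hvpos.ne']
    rw [hnn]
    exact le_iSup_of_le (‖v‖⁻¹ • v) (le_iSup_of_le hn1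
      (le_iSup_of_le ‖v‖ (le_iSup_of_le hcod le_rfl)))
  · rw [hnn]
    refine iSup_le fun u => iSup_le fun hu => iSup_le fun α => iSup_le fun hα => ?_
    apply ENNReal.ofReal_le_ofReal
    have h1 := aux_limitingNCP hf hA P hadd hsmul _ hC _ hα (1, v) htan
    simp only [pinner, inner_neg_left, mul_one] at h1
    have h2 := real_inner_le_norm u v
    nlinarith [norm_nonneg v]

/-- Near a regular point of a hypersurface equal to the frontier of `C`, the membership in `C`
is constant on each side of the hypersurface. -/
lemma aux_side {F : Type*} [NormedAddCommGroup F] [NormedSpace ℝ F]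
    {g : F → ℝ} {A : F →L[ℝ] ℝ} {z : F} (hg : HasStrictFDerivAt g A z) (e : F) (he : A e = 1)
    (hz : g z = 0) (C : Set F) (hC : ∀ᶠ y in 𝓝 z, y ∈ frontier C → g y = 0) :
    ∃ Q : Prop, ∀ᶠ y in 𝓝 z, g y < 0 → (y ∈ C ↔ Q) := by
  have hE : 0 < ‖e‖ + 1 := by positivity
  set c : ℝ := 1 / (2 * (‖e‖ + 1)) with hc
  have hcpos : 0 < c := by positivity
  have hce : c * ‖e‖ ≤ 1 / 2 := by
    rw [hc, div_mul_eq_mul_div, div_le_div_iff₀ (by positivity) (by norm_num)]; linarith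
  obtain ⟨s0, hs0, hap⟩ := hg.approximates_deriv_on_nhds (c := ⟨c, hcpos.le⟩) (Or.inr hcpos)
  obtain ⟨ρ, hρ, hball⟩ := Metric.mem_nhds_iff.1 (Filter.inter_mem hs0 hC)
  set σ : ℝ := ρ / (2 * (‖e‖ + 1)) with hσ
  have hσpos : 0 < σ := by positivity
  have hσe : σ * ‖e‖ ≤ ρ / 2 := by
    rw [hσ, div_mul_eq_mul_div, div_le_div_iff₀ (by positivity) (by norm_num)]; nlinarith
  have hcont := hg.hasFDerivAt.continuousAt
  obtain ⟨r1, hr1, hgr⟩ := Metric.continuousAt_iff.1 hcont (σ / 2) (by positivity)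
  set r := min r1 (ρ / 2) with hr
  have hrpos : 0 < r := by positivity
  have hin : ∀ y ∈ ball z r, ∀ τ ∈ Icc 0 σ, y - τ • e ∈ ball z ρ := by
    intro y hy τ hτ
    rw [mem_ball, dist_eq_norm] at hy ⊢
    have hy2 : ‖y - z‖ < ρ / 2 := hy.trans_le (min_le_right _ _)
    have e1 : y - τ • e - z = (y - z) - τ • e := by abel
    have e2 : ‖τ • e‖ ≤ ρ / 2 := by
      rw [norm_smul, Real.norm_of_nonneg hτ.1]
      exact (mul_le_mul_of_nonneg_right hτ.2 (norm_nonneg _)).trans hσe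
    rw [e1]
    linarith [norm_sub_le (y - z) (τ • e)]
  have hmono : ∀ y ∈ ball z r, ∀ τ ∈ Icc 0 σ, g (y - τ • e) ≤ g y - τ / 2 := by
    intro y hy τ hτ
    have hy0 : y ∈ ball z ρ := by
      have := hin y hy 0 ⟨le_rfl, hσpos.le⟩
      simpa using this
    have h1 := hap _ (hball (hin y hy τ hτ)).1 _ (hball hy0).1
    have e1 : y - τ • e - y = -(τ • e) := by abel
    rw [e1, map_neg, map_smul, he, norm_neg, norm_smul, Real.norm_of_nonneg hτ.1] at h1
    have h2 : |g (y - τ • e) - g y - -(τ • (1 : ℝ))| ≤ c * (τ * ‖e‖) := h1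
    have h3 := (abs_le.1 h2).2
    rw [smul_eq_mul] at h3
    nlinarith [hτ.1]
  have hnf : ∀ w ∈ ball z ρ, g w < 0 → w ∉ frontier C := fun w hw hgw hwf =>
    hgw.ne ((hball hw).2 hwf)
  refine ⟨z - σ • e ∈ C, ?_⟩
  filter_upwards [ball_mem_nhds z hrpos] with y hy hgy
  have hσm : σ ∈ Icc 0 σ := ⟨hσpos.le, le_rfl⟩
  -- the segment
  set T1 : Set F := (fun τ : ℝ => y - τ • e) '' Icc 0 σ with hT1
  have hT1p : IsPreconnected T1 :=
    isPreconnected_Icc.image _ (by fun_prop)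
  have hT1d : ∀ w ∈ T1, w ∉ frontier C := by
    rintro w ⟨τ, hτ, rfl⟩
    exact hnf _ (hin y hy τ hτ) (by linarith [hmono y hy τ hτ, hτ.1])
  have hy1 : y ∈ T1 := ⟨0, ⟨le_rfl, hσpos.le⟩, by simp⟩
  have hy2 : y - σ • e ∈ T1 := ⟨σ, hσm, rfl⟩
  set T2 : Set F := (fun w : F => w - σ • e) '' ball z r with hT2
  have hT2p : IsPreconnected T2 :=
    (convex_ball z r).isPreconnected.image _ (by fun_prop)
  have hT2d : ∀ w ∈ T2, w ∉ frontier C := by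
    rintro w ⟨u, hu, rfl⟩
    refine hnf _ (hin u hu σ hσm) ?_
    have h1 := hmono u hu σ hσm
    have h2 := hgr (x := u) (lt_of_lt_of_le hu (min_le_left _ _))
    rw [hz, Real.dist_eq, sub_zero] at h2
    have h3 := (abs_lt.1 h2).2
    change g (u - σ • e) < 0
    linarith
  have hy3 : y - σ • e ∈ T2 := ⟨y, hy, rfl⟩
  have hz3 : z - σ • e ∈ T2 := ⟨z, mem_ball_self hrpos, rfl⟩
  exact ⟨fun h => aux_preconn hT2p hT2d hy3 hz3 (aux_preconn hT1p hT1d hy1 hy2 h),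
    fun h => aux_preconn hT1p hT1d hy2 hy1 (aux_preconn hT2p hT2d hz3 hy3 h)⟩

/-- Local description of a regular closed set with smooth frontier, at a frontier point. -/
lemma aux_half {F : Type*} [NormedAddCommGroup F] [NormedSpace ℝ F]
    {g : F → ℝ} {A : F →L[ℝ] ℝ} {z : F} (hg : HasStrictFDerivAt g A z)
    (hA : Function.Surjective A) (hz : g z = 0) (C : Set F) (hcl : IsClosed C)
    (hreg : C = closure (interior C)) (hzf : z ∈ frontier C)
    (hC : ∀ᶠ y in 𝓝 z, (y ∈ frontier C ↔ g y = 0)) :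
    ∃ (g' : F → ℝ) (A' : F →L[ℝ] ℝ), HasStrictFDerivAt g' A' z ∧ Function.Surjective A' ∧
      g' z = 0 ∧ ∀ᶠ y in 𝓝 z, (y ∈ C ↔ g' y ∈ Iic (0 : ℝ)) := by
  have hA' : Function.Surjective (-A) := fun y => by
    obtain ⟨w, hw⟩ := hA (-y)
    exact ⟨w, by simp [hw]⟩
  obtain ⟨e, he⟩ := hA 1
  obtain ⟨e', he'⟩ := hA' 1
  obtain ⟨Q, hQ⟩ := aux_side hg e he hz C (hC.mono fun y hy => hy.1)
  obtain ⟨Q', hQ'⟩ := aux_side (g := fun y => - g y) hg.neg e' he' (by simp [hz]) C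
    (hC.mono fun y hy h => by simp [hy.1 h])
  have h0 : ∀ᶠ y in 𝓝 z, g y = 0 → y ∈ C := hC.mono fun y hy h =>
    hcl.frontier_subset (hy.2 h)
  by_cases hq : Q <;> by_cases hq' : Q'
  · exfalso
    apply hzf.2
    rw [mem_interior_iff_mem_nhds]
    filter_upwards [hQ, hQ', h0] with y h1 h2 h3
    rcases lt_trichotomy (g y) 0 with h | h | h
    · exact (h1 h).2 hq
    · exact h3 h
    · exact (h2 (by linarith)).2 hq'
  · refine ⟨g, A, hg, hA, hz, ?_⟩
    filter_upwards [hQ, hQ', h0] with y h1 h2 h3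
    rw [mem_Iic]
    rcases lt_trichotomy (g y) 0 with h | h | h
    · exact ⟨fun _ => h.le, fun _ => (h1 h).2 hq⟩
    · exact ⟨fun _ => h.le, fun _ => h3 h⟩
    · exact ⟨fun hc => absurd ((h2 (by linarith)).1 hc) hq', fun hc => absurd hc (by linarith)⟩
  · refine ⟨fun y => - g y, -A, hg.neg, hA', by simp [hz], ?_⟩
    filter_upwards [hQ, hQ', h0] with y h1 h2 h3
    rw [mem_Iic]
    rcases lt_trichotomy (g y) 0 with h | h | h
    · exact ⟨fun hc => absurd ((h1 h).1 hc) hq, fun hc => absurd hc (by linarith)⟩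
    · exact ⟨fun _ => by linarith, fun _ => h3 h⟩
    · exact ⟨fun _ => by linarith, fun _ => (h2 (by linarith)).2 hq'⟩
  · exfalso
    have hzc : z ∈ closure (interior C) := by
      rw [← hreg]; exact hcl.frontier_subset hzf
    have hev : ∀ᶠ y in 𝓝 z, y ∉ interior C := by
      filter_upwards [hQ, hQ', hC] with y h1 h2 h3 hy
      have hyC := interior_subset hy
      rcases lt_trichotomy (g y) 0 with h | h | h
      · exact hq ((h1 h).1 hyC)
      · exact (h3.2 h).2 hy
      · exact hq' ((h2 (by linarith)).1 hyC)
    exact (mem_closure_iff_frequently.1 hzc) hev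

/-- If the orbit stays in the interior of the graph just after `t`, its velocity is zero. -/
lemma aux_const {E : Type*} [NormedAddCommGroup E] [InnerProductSpace ℝ E]
    [FiniteDimensional ℝ E] (S : ℝ → Set E) (a b : ℝ) (γ γ' : ℝ → E)
    (horb : ACOrbit S (Ico a b) γ γ') (t : ℝ) (ht : t ∈ Ico a b) (v : E)
    (hγ : HasDerivAt γ v t) (hint : ∀ᶠ s in 𝓝[>] t, sgraph S ∈ 𝓝 (s, γ s)) : v = 0 := by
  have : CompleteSpace E := FiniteDimensional.complete ℝ E
  obtain ⟨-, -, hi, hae⟩ := horb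
  obtain ⟨u, hu, hsub⟩ := mem_nhdsGT_iff_exists_Ioo_subset.1 hint
  have hae2 := (ae_restrict_iff' measurableSet_Ico).1 hae
  have hu' : t < u := hu
  have hconst : ∀ s ∈ Ico t (min u b), γ s = γ t := by
    intro s hs
    have hsu : s < u := hs.2.trans_le (min_le_left _ _)
    have hsb : s < b := hs.2.trans_le (min_le_right _ _)
    rw [← sub_eq_zero, hi t ht s ⟨ht.1.trans hs.1, hsb⟩]
    apply intervalIntegral.integral_zero_ae
    filter_upwards [hae2] with τ hτ hτm
    rw [uIoc_of_le hs.1] at hτm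
    have h1 := hτ ⟨ht.1.trans hτm.1.le, hτm.2.trans_lt hsb⟩
    have h2 : sgraph S ∈ 𝓝 (τ, γ τ) := hsub ⟨hτm.1, hτm.2.trans_lt hsu⟩
    have h3 : S τ ∈ 𝓝 (γ τ) :=
      ((Continuous.prodMk_right τ).tendsto (γ τ)) h2
    exact neg_eq_zero.1 (aux_interior _ _ _ h3 h1)
  have hev : γ =ᶠ[𝓝[≥] t] fun _ => γ t := by
    filter_upwards [Ico_mem_nhdsGE (lt_min hu' ht.2)] with s hs using hconst s hs
  have h1 : HasDerivWithinAt γ 0 (Ici t) t :=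
    (hasDerivWithinAt_const t (Ici t) (γ t)).congr_of_eventuallyEq hev rfl
  exact (uniqueDiffWithinAt_Ici t).eq_deriv _ hγ.hasDerivWithinAt h1

/-- Lemma: velocity equals the oriented modulus: if `γ ∈ AC(S,[a,b))`
then `‖γ̇(t)‖ = ‖D*S(t,γ(t))|⁺` at every `t ∈ [a,b)` where `γ` is differentiable,
`-γ̇(t) ∈ N_{S(t)}(γ(t))` and `‖D*S(t,γ(t))|⁺` is finite. -/
theorem statement16 {E : Type*} [NormedAddCommGroup E] [InnerProductSpace ℝ E]
    [FiniteDimensional ℝ E] (S : ℝ → Set E) (hS : SmoothSweepingProcess S)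
    (a b : ℝ) (hab : a < b) (γ γ' : ℝ → E) (horb : ACOrbit S (Ico a b) γ γ') :
    ∀ t ∈ Ico a b, ∀ v : E, HasDerivAt γ v t → -v ∈ limitingNC (S t) (γ t) →
      asymMod S t (γ t) < ⊤ → (‖v‖₊ : ℝ≥0∞) = asymMod S t (γ t) := by
  intro t ht v hγ hnv _
  have : CompleteSpace E := FiniteDimensional.complete ℝ E
  obtain ⟨hcl, -, hcase⟩ := hS
  have hzS : (t, γ t) ∈ sgraph S := horb.1 t ht
  have hright : ∀ᶠ s in 𝓝[>] t, (s, γ s) ∈ sgraph S := by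
    filter_upwards [Ioo_mem_nhdsGT ht.2] with s hs
    exact horb.1 s ⟨ht.1.trans hs.1.le, hs.2⟩
  have hcurve : Tendsto (fun s => (s, γ s)) (𝓝[>] t) (𝓝 (t, γ t)) :=
    (continuousAt_id.prodMk hγ.continuousAt).tendsto.mono_left nhdsWithin_le_nhds
  rcases hcase with ⟨c, -, hM⟩ | ⟨hreg, hM⟩
  · obtain ⟨U, hUo, hzU, f, hfU, hsurj, hMU⟩ := hM _ hzS
    have hUn := hUo.mem_nhds hzU
    have hf : HasStrictFDerivAt f (fderiv ℝ f (t, γ t)) (t, γ t) :=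
      (hfU.contDiffAt hUn).hasStrictFDerivAt one_ne_zero
    have hA := hsurj _ hzU
    rw [fderivWithin_of_isOpen hUo hzU] at hA
    have hiff : ∀ y ∈ U, (y ∈ sgraph S ↔ f y ∈ ({0} : Set (EuclideanSpace ℝ (Fin c)))) := by
      intro y hy
      have h1 : y ∈ sgraph S ∩ U ↔ y ∈ {y ∈ U | f y = 0} := by rw [hMU]
      simpa [hy] using h1
    have hC := Filter.eventually_of_mem hUn hiff
    have hz : f (t, γ t) = 0 := (hiff _ hzU).1 hzS
    have hlim := aux_tangent hf.hasFDerivAt hγ hz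
    have hA1 : fderiv ℝ f (t, γ t) (1, v) = 0 := by
      refine tendsto_nhds_unique hlim ?_
      refine tendsto_const_nhds.congr' ?_
      filter_upwards [hright, hcurve.eventually hC] with s h1 h2
      have h3 : f (s, γ s) = 0 := h2.1 h1
      simp [h3]
    exact aux_local S t (γ t) v hf hA hz {0} rfl (by simp) (by simp) hC hA1 (fun _ => hA1) hnv
  · by_cases hzi : (t, γ t) ∈ interior (sgraph S)
    · have hn := mem_interior_iff_mem_nhds.1 hzi
      exact aux_local (Y := EuclideanSpace ℝ (Fin 0)) (f := fun _ => 0) (A := 0) S t (γ t) v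
        (hasStrictFDerivAt_const _ _) (fun y => ⟨0, Subsingleton.elim _ _⟩) rfl univ trivial
        (by simp) (by simp) (by filter_upwards [hn] with y hy; simpa using hy) trivial
        (fun _ => rfl) hnv
    · have hzf : (t, γ t) ∈ frontier (sgraph S) := ⟨subset_closure hzS, hzi⟩
      obtain ⟨U, hUo, hzU, f, hfU, hsurj, hMU⟩ := hM _ hzf
      have hUn := hUo.mem_nhds hzU
      have hf : HasStrictFDerivAt f (fderiv ℝ f (t, γ t)) (t, γ t) :=
        (hfU.contDiffAt hUn).hasStrictFDerivAt one_ne_zero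
      have hA := hsurj _ hzU
      rw [fderivWithin_of_isOpen hUo hzU] at hA
      set L : EuclideanSpace ℝ (Fin 1) →L[ℝ] ℝ := EuclideanSpace.proj 0 with hL
      have hLa : ∀ p, L p = p 0 := fun p => rfl
      have hL0 : ∀ p, p = 0 ↔ L p = 0 := fun p => by
        constructor
        · rintro rfl; simp
        · intro h; ext i; fin_cases i; simpa [hLa] using h
      have hg : HasStrictFDerivAt (fun y => L (f y)) (L.comp (fderiv ℝ f (t, γ t))) (t, γ t) :=
        L.hasStrictFDerivAt.comp _ hf
      have hLs : Function.Surjective (L.comp (fderiv ℝ f (t, γ t))) := by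
        intro y
        obtain ⟨w, hw⟩ := hA (EuclideanSpace.single 0 y)
        exact ⟨w, by simp [hw, hLa]⟩
      have hiff : ∀ y ∈ U, (y ∈ frontier (sgraph S) ↔ L (f y) = 0) := by
        intro y hy
        have h1 : y ∈ frontier (sgraph S) ∩ U ↔ y ∈ {y ∈ U | f y = 0} := by rw [hMU]
        rw [← hL0]
        simpa [hy] using h1
      obtain ⟨g, A, hg', hAs, hz, hC⟩ := aux_half hg hLs ((hiff _ hzU).1 hzf) (sgraph S) hcl hreg
        hzf (Filter.eventually_of_mem hUn hiff)
      have hlim := aux_tangent hg'.hasFDerivAt hγ hz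
      have hA1 : A (1, v) ≤ 0 := by
        refine le_of_tendsto hlim ?_
        filter_upwards [hright, hcurve.eventually hC, self_mem_nhdsWithin] with s h1 h2 h3
        have h4 : g (s, γ s) ≤ 0 := h2.1 h1
        have h5 : 0 < s - t := sub_pos.2 h3
        exact mul_nonpos_of_nonneg_of_nonpos (inv_nonneg.2 h5.le) h4
      refine aux_local S t (γ t) v hg' hAs hz (Iic 0) (by simp)
        (fun p hp q hq => by simp only [mem_Iic] at *; linarith)
        (fun s hs p hp => mul_nonpos_of_nonneg_of_nonpos hs.le hp) hC hA1 ?_ hnv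
      intro hv
      by_contra hne
      have hlt : A (1, v) < 0 := lt_of_le_of_ne hA1 hne
      refine hv (aux_const S a b γ γ' horb t ht v hγ ?_)
      have hcont : ∀ᶠ y in 𝓝 (t, γ t), ContinuousAt g y := by
        obtain ⟨s0, hs0, hap⟩ := hg'.approximates_deriv_on_nhds (c := 1) (Or.inr one_pos)
        filter_upwards [eventually_mem_nhds_iff.2 hs0] with y hy
        exact hap.continuousOn.continuousAt hy
      filter_upwards [hlim.eventually (gt_mem_nhds hlt), hcurve.eventually hC.eventually_nhds,
        hcurve.eventually hcont, self_mem_nhdsWithin] with s h1 h2 h3 h4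
      have h5 : 0 < s - t := sub_pos.2 h4
      have h6 : g (s, γ s) < 0 := by
        rw [smul_eq_mul] at h1
        by_contra hcon
        exact absurd h1 (not_lt.2 (mul_nonneg (inv_nonneg.2 h5.le) (not_lt.1 hcon)))
      filter_upwards [h2, h3.eventually (gt_mem_nhds h6)] with y h7 h8
      exact h7.2 h8.le
end
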